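/- arXiv:1310.0227 — 4 statements merged into one kernel-verified Lean document; each statement's English description precedes it below -/
import Mathlib

section
/- Let I ⊂ C[x_0,...,x_n] be a homogeneous ideal, d ≥ 2 an integer, and c := dim_C (S/I)_d. Then dim_C (S/I)_{d-1} ≥ c_{*d}, where c_{*d} := Σ_{i=2}^d binom(i + ε_i - 1, i - 1) for the Macaulay expansion c = Σ_{i=1}^d binom(i + ε_i, i) in base d. Moreover, if ε_1 ≥ 0 then the inequality is strict. -/
open MvPolynomial

attribute [local instance] MvPolynomial.gradedAlgebra

/-- The term `binom(i + e, i)` of a Macaulay expansion, with the convention that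
it vanishes when `i + e < i`. -/
def macaulayTerm (i : ℕ) (e : ℤ) : ℕ := ((i : ℤ) + e).toNat.choose i

/-- `ε : Fin d → ℤ`, where `ε i` stands for `ε_{i+1}`, is the Macaulay expansion of `c`
in base `d`. -/
def IsMacaulayExpansion (d c : ℕ) (ε : Fin d → ℤ) : Prop :=
  Monotone ε ∧ (∀ i, -1 ≤ ε i) ∧ c = ∑ i : Fin d, macaulayTerm (i.1 + 1) (ε i)

/-- Hilbert function of an ideal `I ⊆ S = ℂ[x_0,…,x_{m-1}]`: `h_I(k) = dim_ℂ (S/I)_k`. -/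
noncomputable def hilb (m : ℕ) (I : Ideal (MvPolynomial (Fin m) ℂ)) (k : ℕ) : ℕ :=
  Module.finrank ℂ
    (↥(homogeneousSubmodule (Fin m) ℂ k) ⧸
      Submodule.comap (homogeneousSubmodule (Fin m) ℂ k).subtype (Submodule.restrictScalars ℂ I))

namespace MacaulayBound

section Pencil

variable {M : Type*} [AddCommGroup M] [Module ℂ M]

/-- If `∑ t ^ k • v k` lies in `U` for every scalar `t`, then every coefficient `v k` does. -/
lemma coeff_mem_of_forall_sum_mem {U : Submodule ℂ M} {n : ℕ} {v : ℕ → M}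
    (h : ∀ t : ℂ, ∑ k ∈ Finset.range n, t ^ k • v k ∈ U) {k : ℕ} (hk : k < n) : v k ∈ U := by
  by_contra hv
  obtain ⟨f, hf, hU⟩ := Submodule.exists_le_ker_of_notMem hv
  let p : Polynomial ℂ := ∑ i ∈ Finset.range n, Polynomial.monomial i (f (v i))
  have hp : p = 0 := by
    refine Polynomial.funext fun t => ?_
    have := hU (h t)
    simp only [LinearMap.mem_ker, map_sum, map_smul, smul_eq_mul] at this
    simp only [p, Polynomial.eval_finsetSum, Polynomial.eval_monomial, Polynomial.eval_zero]
    simpa only [mul_comm] using this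
  apply hf
  have := congrArg (fun q => Polynomial.coeff q k) hp
  simpa [p, Polynomial.finsetSum_coeff, Polynomial.coeff_monomial, hk] using this

/-- Linear independence is preserved by some arbitrarily chosen nonzero small perturbation. -/
lemma exists_ne_zero_linearIndependent_sub {r : ℕ} {v : Fin r → M}
    (hv : LinearIndependent ℂ v) (v' : Fin r → M) :
    ∃ t : ℂ, t ≠ 0 ∧ LinearIndependent ℂ fun i => v i - t • v' i := by
  obtain ⟨g, hg⟩ := LinearMap.exists_leftInverse_of_injective
    (Fintype.linearCombination ℂ v)
    (LinearMap.ker_eq_bot.2 (linearIndependent_iff_injective_fintypeLinearCombination.1 hv))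
  have hgv : ∀ i, g (v i) = Pi.single i 1 := fun i => by
    have := LinearMap.congr_fun hg (Pi.single i 1)
    simpa [Fintype.linearCombination_apply_single] using this
  let N : ℂ → Matrix (Fin r) (Fin r) ℂ := fun t => Matrix.of fun i j => (g (v i - t • v' i)) j
  have hcont : Continuous fun t => (N t).det := by
    refine Continuous.matrix_det (continuous_matrix fun i j => ?_)
    simp only [N, Matrix.of_apply, map_sub, map_smul, Pi.sub_apply, Pi.smul_apply, smul_eq_mul]
    fun_prop
  have h0 : (N 0).det ≠ 0 := by
    have : N 0 = 1 := by
      ext i j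
      simp [N, hgv, Matrix.one_apply, Pi.single_apply, eq_comm]
    simp [this]
  have hev : ∀ᶠ t in nhdsWithin (0 : ℂ) {0}ᶜ, (N t).det ≠ 0 :=
    (hcont.continuousAt.eventually_ne h0).filter_mono nhdsWithin_le_nhds
  obtain ⟨t, ht, ht0⟩ := (hev.and self_mem_nhdsWithin).exists
  refine ⟨t, ht0, LinearIndependent.of_comp g ?_⟩
  exact Matrix.linearIndependent_rows_of_det_ne_zero ht

/-- If `A` has maximal rank on `W` in the pencil `A - t B`, a vector lying in the image of `W`
under every other member of the pencil lies in `A W`. -/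
lemma mem_map_of_maximal_rank {A B : M →ₗ[ℂ] M} {W : Submodule ℂ M} [FiniteDimensional ℂ W]
    (hmax : ∀ t : ℂ, Module.finrank ℂ (W.map (A - t • B)) ≤ Module.finrank ℂ (W.map A)) {v : M}
    (hv : ∀ t : ℂ, t ≠ 0 → v ∈ W.map (A - t • B)) : v ∈ W.map A := by
  by_contra hvA
  let b := Module.finBasis ℂ (W.map A)
  choose u huW hu using fun i => Submodule.mem_map.1 (b i).2
  have hli : LinearIndependent ℂ fun i => (b i : M) :=
    b.linearIndependent.map' _ (Submodule.ker_subtype _)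
  have hspan : Submodule.span ℂ (Set.range fun i => (b i : M)) ≤ W.map A := by
    rw [Submodule.span_le]
    rintro _ ⟨i, rfl⟩
    exact (b i).2
  have hcons : LinearIndependent ℂ (Fin.cons v fun i => (b i : M) : Fin (_ + 1) → M) :=
    linearIndependent_finCons.2 ⟨hli, fun h => hvA (hspan h)⟩
  obtain ⟨t, ht0, ht⟩ := exists_ne_zero_linearIndependent_sub hcons
    (Fin.cons 0 fun i => B (u i))
  have hmem : ∀ i, (Fin.cons v (fun i => (b i : M)) : Fin (_ + 1) → M) i -
      t • (Fin.cons 0 (fun i => B (u i)) : Fin (_ + 1) → M) i ∈ W.map (A - t • B) := by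
    intro i
    refine Fin.cases ?_ (fun i => ?_) i
    · simpa using hv t ht0
    · refine Submodule.mem_map.2 ⟨u i, huW i, ?_⟩
      simp [hu]
  have hli' : LinearIndependent ℂ fun i => (⟨_, hmem i⟩ : W.map (A - t • B)) :=
    LinearIndependent.of_comp (W.map (A - t • B)).subtype ht
  have := hli'.fintype_card_le_finrank
  rw [Fintype.card_fin] at this
  have := hmax t
  omega

/-- The vectors ending a chain `A u₀ = 0`, `A uᵢ₊₁ = B uᵢ` of length `i` in `W`. -/
def pencilChain (A B : M →ₗ[ℂ] M) (W : Submodule ℂ M) : ℕ → Submodule ℂ M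
  | 0 => W ⊓ LinearMap.ker A
  | i + 1 => W ⊓ ((pencilChain A B W i).map B).comap A

lemma exists_mem_pencil_apply_eq (A B : M →ₗ[ℂ] M) (W : Submodule ℂ M) (t : ℂ) (i : ℕ) :
    ∀ u ∈ pencilChain A B W i, ∃ p ∈ W, (A - t • B) p = -(t ^ (i + 1) • B u) := by
  induction i with
  | zero =>
    rintro u ⟨huW, hu⟩
    refine ⟨u, huW, ?_⟩
    simp [LinearMap.mem_ker.1 hu]
  | succ i ih =>
    rintro u ⟨huW, u', hu', hu⟩
    obtain ⟨p, hpW, hp⟩ := ih u' hu'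
    refine ⟨p + t ^ (i + 1) • u, W.add_mem hpW (W.smul_mem _ huW), ?_⟩
    rw [map_add, hp, hu]
    simp only [LinearMap.sub_apply, LinearMap.smul_apply, map_smul, smul_sub, smul_smul]
    rw [pow_succ t (i + 1), mul_comm (t ^ (i + 1)) t]
    abel

lemma pencilChain_map_le {A B : M →ₗ[ℂ] M} {W : Submodule ℂ M} [FiniteDimensional ℂ W]
    (hmax : ∀ t : ℂ, Module.finrank ℂ (W.map (A - t • B)) ≤ Module.finrank ℂ (W.map A)) (i : ℕ) :
    (pencilChain A B W i).map B ≤ W.map A := by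
  rintro _ ⟨u, hu, rfl⟩
  refine mem_map_of_maximal_rank hmax fun t ht => ?_
  obtain ⟨p, hpW, hp⟩ := exists_mem_pencil_apply_eq A B W t i u hu
  refine Submodule.mem_map.2 ⟨-((t ^ (i + 1))⁻¹ • p), W.neg_mem (W.smul_mem _ hpW), ?_⟩
  rw [map_neg, map_smul, hp, smul_neg, neg_neg, inv_smul_smul₀ (pow_ne_zero _ ht)]

/-- If `A` has maximal rank on `W` in the pencil `A - t B` and commutes with `B`, then
`B ^ j` maps `W ∩ ker A` into `A ^ j W`. -/
lemma pow_apply_mem_map_pow {A B : M →ₗ[ℂ] M} (hAB : Commute A B) {W : Submodule ℂ M}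
    [FiniteDimensional ℂ W]
    (hmax : ∀ t : ℂ, Module.finrank ℂ (W.map (A - t • B)) ≤ Module.finrank ℂ (W.map A)) (j : ℕ)
    {w : M} (hw : w ∈ W ⊓ LinearMap.ker A) : (B ^ j) w ∈ W.map (A ^ j) := by
  suffices h : ∃ u ∈ pencilChain A B W j, (A ^ j) u = (B ^ j) w by
    obtain ⟨u, hu, h⟩ := h
    refine Submodule.mem_map.2 ⟨u, ?_, h⟩
    cases j <;> exact hu.1
  induction j with
  | zero => exact ⟨w, hw, rfl⟩
  | succ j ih =>
    obtain ⟨u, hu, h⟩ := ih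
    obtain ⟨u', hu'W, hu'⟩ := pencilChain_map_le hmax j (Submodule.mem_map_of_mem hu)
    refine ⟨u', ⟨hu'W, Submodule.mem_comap.2 (hu' ▸ Submodule.mem_map_of_mem hu)⟩, ?_⟩
    rw [pow_succ, Module.End.mul_apply, hu', ← Module.End.mul_apply, (hAB.pow_left j).eq,
      Module.End.mul_apply, h, ← Module.End.mul_apply, ← pow_succ']

/-- First-order polarization. -/
lemma pow_apply_apply_mem {P Q : M →ₗ[ℂ] M} (hPQ : Commute P Q) {U : Submodule ℂ M} {j : ℕ} {w : M}
    (h : ∀ t : ℂ, ((t • Q + P) ^ (j + 1)) w ∈ U) : (P ^ j) (Q w) ∈ U := by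
  have key : ((j + 1 : ℕ) : ℂ) • (P ^ j) (Q w) ∈ U := by
    have := coeff_mem_of_forall_sum_mem (U := U) (n := j + 1 + 1)
      (v := fun k => ((j + 1).choose k : ℂ) • (P ^ (j + 1 - k)) ((Q ^ k) w)) (fun t => ?_)
      (k := 1) (by omega)
    · simpa using this
    · convert h t
      rw [((hPQ.symm).smul_left t).add_pow, LinearMap.sum_apply]
      refine Finset.sum_congr rfl fun k _ => ?_
      rw [smul_pow, (((hPQ.symm).pow_left k).pow_right _ |>.smul_left (t ^ k)).eq,
        (Nat.cast_commute ((j + 1).choose k) _).symm.eq]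
      simp only [Module.End.mul_apply, LinearMap.smul_apply, map_smul,
        Module.End.natCast_apply, ← Nat.cast_smul_eq_nsmul ℂ]
  exact (U.smul_mem_iff (Nat.cast_ne_zero.2 j.succ_ne_zero)).1 key

end Pencil

section Multichoose

lemma multichoose_add_two_eq (a k : ℕ) :
    a.multichoose (k + 2) = a.multichoose (k + 1) + (a - 1).multichoose (k + 2) := by
  cases a with
  | zero => simp
  | succ a => rw [Nat.multichoose_succ_succ, Nat.add_sub_cancel, add_comm]

lemma multichoose_succ_eq_sum_add_one (a k : ℕ) :
    (a + 1).multichoose k = ∑ i ∈ Finset.range k, a.multichoose (i + 1) + 1 := by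
  induction k with
  | zero => simp
  | succ k ih => rw [Finset.sum_range_succ, Nat.multichoose_succ_succ, ih]; omega

lemma multichoose_le_one_add_sum (a k : ℕ) :
    a.multichoose k ≤ 1 + ∑ i ∈ Finset.range k, (a - 1).multichoose (i + 1) := by
  cases a with
  | zero => cases k <;> simp
  | succ a => rw [multichoose_succ_eq_sum_add_one, Nat.add_sub_cancel, add_comm]

lemma eq_zero_of_multichoose_eq_zero {a k : ℕ} (h : a.multichoose k = 0) : a = 0 := by
  cases a with
  | zero => rfl
  | succ a => rw [multichoose_succ_eq_sum_add_one] at h; omega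

/-- Decrementing a nonzero sum `∑ multichoose (a i) (i + 1)` lowers the sum of the
`multichoose (a i) i` over `1 ≤ i` by at most one, and not at all if `a 0 ≠ 0`. -/
lemma exists_sum_multichoose_add_one_eq (a : ℕ → ℕ) (n : ℕ)
    (h : ∑ i ∈ Finset.range (n + 1), (a i).multichoose (i + 1) ≠ 0) :
    ∃ b : ℕ → ℕ, ∑ i ∈ Finset.range (n + 1), (b i).multichoose (i + 1) + 1 =
        ∑ i ∈ Finset.range (n + 1), (a i).multichoose (i + 1) ∧
      ∑ i ∈ Finset.range n, (a (i + 1)).multichoose (i + 1) + (if a 0 = 0 then 0 else 1) ≤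
        ∑ i ∈ Finset.range n, (b (i + 1)).multichoose (i + 1) + 1 := by
  induction n with
  | zero =>
    refine ⟨fun i => a i - 1, ?_, ?_⟩
    · simp at h ⊢
      omega
    · simp
      split_ifs <;> omega
  | succ n ih =>
    by_cases h0 : ∑ i ∈ Finset.range (n + 1), (a i).multichoose (i + 1) = 0
    · have ha : ∀ i ≤ n, a i = 0 := fun i hi => eq_zero_of_multichoose_eq_zero
        (Finset.sum_eq_zero_iff.1 h0 i (Finset.mem_range.2 (Nat.lt_succ_of_le hi)))
      rw [Finset.sum_range_succ, h0, zero_add] at h ⊢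
      obtain ⟨c, hc⟩ : ∃ c, a (n + 1) = c + 1 := Nat.exists_eq_succ_of_ne_zero fun h' => h (by
        rw [h', Nat.multichoose_zero_succ])
      have hlow : ∑ i ∈ Finset.range n, (a (i + 1)).multichoose (i + 1) = 0 :=
        Finset.sum_eq_zero fun i hi => by
          rw [ha (i + 1) (Finset.mem_range.1 hi), Nat.multichoose_zero_succ]
      refine ⟨fun _ => c, ?_, ?_⟩
      · rw [hc, multichoose_succ_eq_sum_add_one]
      · rw [Finset.sum_range_succ, hlow, if_pos (ha 0 n.zero_le), hc,
          multichoose_succ_eq_sum_add_one, zero_add, add_zero]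
    · obtain ⟨b, hb, hb'⟩ := ih h0
      have hlt : ∀ i ∈ Finset.range (n + 1),
          (Function.update b (n + 1) (a (n + 1)) i).multichoose (i + 1) =
            (b i).multichoose (i + 1) := fun i hi => by
        rw [Function.update_of_ne (Finset.mem_range.1 hi).ne]
      have hlt' : ∀ i ∈ Finset.range n,
          (Function.update b (n + 1) (a (n + 1)) (i + 1)).multichoose (i + 1) =
            (b (i + 1)).multichoose (i + 1) := fun i hi => by
        rw [Function.update_of_ne (by simpa using (Finset.mem_range.1 hi).ne)]
      refine ⟨Function.update b (n + 1) (a (n + 1)), ?_, ?_⟩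
      · rw [Finset.sum_range_succ, Finset.sum_range_succ _ (n + 1), Finset.sum_congr rfl hlt,
          Function.update_self]
        omega
      · rw [Finset.sum_range_succ, Finset.sum_range_succ _ n, Finset.sum_congr rfl hlt',
          Function.update_self]
        omega

lemma sum_multichoose_lt_sum_sum (a : ℕ → ℕ) (d : ℕ) :
    ∑ i ∈ Finset.range d, (a (i + 1)).multichoose (i + 1) <
      ∑ j ∈ Finset.range (d + 1),
        (1 + ∑ i ∈ Finset.range (d - j), (a (i + (j + 1)) - 1).multichoose (i + 1)) := by
  induction d with
  | zero => simp
  | succ d ih =>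
    have hstep : ∀ j ∈ Finset.range (d + 1),
        (1 + ∑ i ∈ Finset.range (d + 1 - j), (a (i + (j + 1)) - 1).multichoose (i + 1)) =
        (1 + ∑ i ∈ Finset.range (d - j), (a (i + (j + 1)) - 1).multichoose (i + 1)) +
          (a (d + 1) - 1).multichoose (d + 1 - 1 - j + 1) := by
      intro j hj
      have hj' : j ≤ d := by simpa [Nat.lt_succ_iff] using hj
      rw [Nat.succ_sub hj', Finset.sum_range_succ, ← add_assoc]
      rw [show d - j + (j + 1) = d + 1 by omega, show d + 1 - 1 - j = d - j by omega]
    rw [Finset.sum_range_succ, Finset.sum_range_succ _ (d + 1), Finset.sum_congr rfl hstep,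
      Finset.sum_add_distrib,
      Finset.sum_range_reflect (fun i => (a (d + 1) - 1).multichoose (i + 1)) (d + 1)]
    have := multichoose_le_one_add_sum (a (d + 1)) (d + 1)
    simp only [Nat.sub_self, Finset.range_zero, Finset.sum_empty]
    omega

lemma sum_pred_multichoose_lt {a : ℕ → ℕ} {d s w : ℕ}
    (hs : s ≤ ∑ i ∈ Finset.range d, (a (i + 1)).multichoose (i + 1))
    (h : ∑ i ∈ Finset.range (d + 1), (a i).multichoose (i + 1) < s + w) :
    ∑ i ∈ Finset.range (d + 1), (a i - 1).multichoose (i + 1) < w := by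
  rw [Finset.sum_range_succ'] at h ⊢
  simp only [multichoose_add_two_eq (a _), add_assoc, Nat.reduceAdd, Finset.sum_add_distrib,
    zero_add, Nat.multichoose_one_right] at h ⊢
  omega

end Multichoose

section Shadow

variable {V M : Type*} [AddCommGroup V] [Module ℂ V] [AddCommGroup M] [Module ℂ M]

/-- The span of all `act x w` with `w ∈ W`. -/
abbrev shadow (act : V →ₗ[ℂ] M →ₗ[ℂ] M) (W : Submodule ℂ M) : Submodule ℂ M :=
  Submodule.map₂ act ⊤ W

variable {act : V →ₗ[ℂ] M →ₗ[ℂ] M}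

lemma shadow_iterate_finiteDimensional [FiniteDimensional ℂ V] (W : Submodule ℂ M)
    [FiniteDimensional ℂ W] (j : ℕ) : FiniteDimensional ℂ ((shadow act)^[j] W) := by
  induction j with
  | zero => assumption
  | succ j ih =>
    rw [Function.iterate_succ_apply']
    exact Module.Finite.iff_fg.2 (Submodule.FG.map₂ _ (Module.finite_def.1 ‹_›)
      (Module.Finite.iff_fg.1 ih))

lemma shadow_iterate_le_of_pow (hcomm : ∀ x y, Commute (act x) (act y)) {U : Submodule ℂ M}
    (j : ℕ) (W : Submodule ℂ M) (h : ∀ y, ∀ w ∈ W, ((act y) ^ j) w ∈ U) :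
    (shadow act)^[j] W ≤ U := by
  induction j generalizing W with
  | zero => exact fun w hw => h 0 w hw
  | succ j ih =>
    refine ih _ fun y u hu => ?_
    suffices hle : shadow act W ≤ U.comap ((act y) ^ j) from hle hu
    refine Submodule.map₂_le.2 fun z _ w hw => ?_
    refine pow_apply_apply_mem (hcomm y z) fun t => ?_
    simpa using h (t • z + y) w hw

lemma shadow_iterate_le_ker (hcomm : ∀ x y, Commute (act x) (act y)) {z : V} {W : Submodule ℂ M}
    (h : W ≤ LinearMap.ker (act z)) (j : ℕ) :
    (shadow act)^[j] W ≤ LinearMap.ker (act z) := by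
  induction j generalizing W with
  | zero => exact h
  | succ j ih =>
    refine ih (Submodule.map₂_le.2 fun y _ w hw => ?_)
    rw [LinearMap.mem_ker, ← Module.End.mul_apply, (hcomm z y).eq, Module.End.mul_apply,
      LinearMap.mem_ker.1 (h hw), map_zero]

lemma shadow_iterate_le_degree {D : ℕ → Submodule ℂ M}
    (hD : ∀ e x, ∀ w ∈ D (e + 1), act x w ∈ D e) {W : Submodule ℂ M} (j : ℕ) {d : ℕ}
    (h : W ≤ D (d + j)) : (shadow act)^[j] W ≤ D d := by
  induction j generalizing W with
  | zero => exact h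
  | succ j ih => exact ih (Submodule.map₂_le.2 fun y _ w hw => hD _ y w (h hw))

lemma finrank_map_add_finrank_inf_ker (A : M →ₗ[ℂ] M) (W : Submodule ℂ M)
    [FiniteDimensional ℂ W] :
    Module.finrank ℂ (W.map A) + Module.finrank ℂ (W ⊓ LinearMap.ker A : Submodule ℂ M) =
      Module.finrank ℂ W := by
  have h := LinearMap.finrank_range_add_finrank_ker (A.domRestrict W)
  rwa [LinearMap.range_domRestrict, LinearMap.ker_domRestrict,
    ← Submodule.finrank_map_subtype_eq, Submodule.map_comap_subtype] at h

lemma sum_finrank_inf_ker_le (A : M →ₗ[ℂ] M) (W : Submodule ℂ M) [FiniteDimensional ℂ W]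
    (n : ℕ) :
    ∑ j ∈ Finset.range n,
      Module.finrank ℂ (W.map (A ^ (j + 1)) ⊓ LinearMap.ker A : Submodule ℂ M) +
      Module.finrank ℂ (W.map (A ^ (n + 1))) = Module.finrank ℂ (W.map A) := by
  induction n with
  | zero => rw [Finset.range_zero, Finset.sum_empty, zero_add, zero_add, pow_one]
  | succ n ih =>
    have := finrank_map_add_finrank_inf_ker A (W.map (A ^ (n + 1)))
    rw [← Submodule.map_comp, ← Module.End.mul_eq_comp, ← pow_succ'] at this
    rw [Finset.sum_range_succ]
    omega

/-- Some `act x` has maximal rank on `W`. -/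
lemma exists_forall_finrank_map_le (act : V →ₗ[ℂ] M →ₗ[ℂ] M) (W : Submodule ℂ M)
    [FiniteDimensional ℂ W] :
    ∃ x, ∀ y, Module.finrank ℂ (W.map (act y)) ≤ Module.finrank ℂ (W.map (act x)) := by
  have hfin : (Set.range fun y => Module.finrank ℂ (W.map (act y))).Finite := by
    refine (Set.finite_Iic (Module.finrank ℂ W)).subset ?_
    rintro _ ⟨y, rfl⟩
    exact Submodule.finrank_map_le _ _
  obtain ⟨_, ⟨x, rfl⟩, hx⟩ := hfin.exists_maximal (Set.range_nonempty _)
  exact ⟨x, fun y => (le_total _ _).elim (hx ⟨y, rfl⟩) id⟩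

/-- Macaulay's bound for a commuting family of degree-lowering operators which jointly kill no
nonzero vector of positive degree: the dimension of the shadow is at least the Macaulay bound. -/
theorem sum_multichoose_lt_finrank_shadow [FiniteDimensional ℂ V]
    (hcomm : ∀ x y, Commute (act x) (act y)) {D : ℕ → Submodule ℂ M}
    (hD : ∀ e x, ∀ w ∈ D (e + 1), act x w ∈ D e)
    (hnd : ∀ e, ∀ w ∈ D (e + 1), (∀ x, act x w = 0) → w = 0)
    (Z : Submodule ℂ V) (d : ℕ) (W : Submodule ℂ M) [FiniteDimensional ℂ W] (hW : W ≤ D (d + 1))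
    (hZ : ∀ z ∈ Z, W ≤ LinearMap.ker (act z)) (a : ℕ → ℕ)
    (ha : ∑ i ∈ Finset.range (d + 1), (a i).multichoose (i + 1) < Module.finrank ℂ W) :
    ∑ i ∈ Finset.range d, (a (i + 1)).multichoose (i + 1) <
      Module.finrank ℂ (shadow act W) := by
  induction Z using WellFoundedGT.induction generalizing d W a with
  | ind Z ih =>
  obtain ⟨x, hx⟩ := exists_forall_finrank_map_le act W
  have hxZ : x ∉ Z := by
    intro hxZ
    have hbot : W = ⊥ := by
      refine (Submodule.eq_bot_iff _).2 fun w hw => hnd d w (hW hw) fun y => ?_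
      have h0 : W.map (act x) = ⊥ :=
        eq_bot_iff.2 (Submodule.map_le_iff_le_comap.2 (hZ x hxZ))
      have hy : W.map (act y) = ⊥ := by
        rw [← Submodule.finrank_eq_zero (R := ℂ)]
        have := hx y
        rw [h0, finrank_bot] at this
        omega
      have hmem : act y w ∈ W.map (act y) := Submodule.mem_map_of_mem hw
      rwa [hy, Submodule.mem_bot] at hmem
    rw [hbot, finrank_bot] at ha
    exact Nat.not_lt_zero _ ha
  have hZ' : Z < Z ⊔ Submodule.span ℂ {x} :=
    left_lt_sup.2 fun h => hxZ (h (Submodule.mem_span_singleton_self x))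
  by_contra! hle
  have hshadow : FiniteDimensional ℂ (shadow act W) :=
    shadow_iterate_finiteDimensional W 1
  have hmap : Module.finrank ℂ (W.map (act x)) ≤ Module.finrank ℂ (shadow act W) := by
    refine Submodule.finrank_mono ?_
    rintro _ ⟨w, hw, rfl⟩
    exact Submodule.apply_mem_map₂ _ trivial hw
  let K : Submodule ℂ M := W ⊓ LinearMap.ker (act x)
  have hKfin : FiniteDimensional ℂ K :=
    Submodule.finiteDimensional_of_le (inf_le_left : K ≤ W)
  have hK : ∀ z ∈ Z ⊔ Submodule.span ℂ {x}, K ≤ LinearMap.ker (act z) := by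
    intro z hz w hw
    obtain ⟨z', hz', y, hy, rfl⟩ := Submodule.mem_sup.1 hz
    obtain ⟨c, rfl⟩ := Submodule.mem_span_singleton.1 hy
    have h1 := LinearMap.mem_ker.1 (hZ z' hz' hw.1)
    have h2 := LinearMap.mem_ker.1 hw.2
    simp [h1, h2]
  have hKfinrank : ∑ i ∈ Finset.range (d + 1), (a i - 1).multichoose (i + 1) <
      Module.finrank ℂ K :=
    sum_pred_multichoose_lt (hmap.trans hle)
      (by rw [finrank_map_add_finrank_inf_ker]; exact ha)
  have hiter : ∀ j ≤ d + 1,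
      ∑ i ∈ Finset.range (d + 1 - j), (a (i + j) - 1).multichoose (i + 1) <
        Module.finrank ℂ ((shadow act)^[j] K) := by
    intro j hj
    induction j with
    | zero => exact hKfinrank
    | succ j ihj =>
      have h := ihj (by omega)
      have hfin := shadow_iterate_finiteDimensional (act := act) K j
      have hdeg : (shadow act)^[j] K ≤ D (d - j + 1) :=
        shadow_iterate_le_degree hD j
          (by rw [show d - j + 1 + j = d + 1 by omega]; exact inf_le_left.trans hW)
      rw [show d + 1 - j = d - j + 1 by omega] at h
      have := ih _ hZ' (d - j) ((shadow act)^[j] K) hdeg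
        (fun z hz => shadow_iterate_le_ker hcomm (hK z hz) j) (fun i => a (i + j) - 1) h
      rw [Function.iterate_succ_apply', show d + 1 - (j + 1) = d - j by omega]
      simpa only [add_assoc, add_comm 1 j] using this
  have hincl : ∀ j, (shadow act)^[j] K ≤ W.map ((act x) ^ j) ⊓ LinearMap.ker (act x) := by
    refine fun j => le_inf (shadow_iterate_le_of_pow hcomm j K fun y w hw => ?_)
      (shadow_iterate_le_ker hcomm inf_le_right j)
    refine pow_apply_mem_map_pow (hcomm x y) (fun t => ?_) j hw
    have := hx (x - t • y)
    rwa [map_sub, map_smul] at this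
  have hsum : ∑ j ∈ Finset.range (d + 1),
      (1 + ∑ i ∈ Finset.range (d - j), (a (i + (j + 1)) - 1).multichoose (i + 1)) ≤
      ∑ j ∈ Finset.range (d + 1), Module.finrank ℂ
        (W.map ((act x) ^ (j + 1)) ⊓ LinearMap.ker (act x) : Submodule ℂ M) := by
    refine Finset.sum_le_sum fun j hj => ?_
    have h1 := hiter (j + 1) (by simpa [Nat.lt_succ_iff] using hj)
    have h2 := Submodule.finrank_mono (hincl (j + 1))
    rw [show d + 1 - (j + 1) = d - j by omega] at h1
    omega
  have h1 := sum_multichoose_lt_sum_sum a d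
  have h2 := sum_finrank_inf_ker_le (act x) W (d + 1)
  omega

end Shadow

section Hilbert

variable {m : ℕ}

/-- The polynomials whose degree `d` component lies in `I`. -/
noncomputable def componentIn (I : Ideal (MvPolynomial (Fin m) ℂ)) (d : ℕ) :
    Submodule ℂ (MvPolynomial (Fin m) ℂ) :=
  (I.restrictScalars ℂ).comap (homogeneousComponent d)

/-- The functionals on the polynomial ring concentrated in degree `d` and vanishing on `I`. -/
noncomputable def inverseSystem (I : Ideal (MvPolynomial (Fin m) ℂ)) (d : ℕ) :
    Submodule ℂ (Module.Dual ℂ (MvPolynomial (Fin m) ℂ)) :=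
  (componentIn I d).dualAnnihilator

/-- Linear forms acting on functionals by precomposition with multiplication. -/
noncomputable def contraction (m : ℕ) :
    homogeneousSubmodule (Fin m) ℂ 1 →ₗ[ℂ]
      Module.Dual ℂ (MvPolynomial (Fin m) ℂ) →ₗ[ℂ] Module.Dual ℂ (MvPolynomial (Fin m) ℂ) :=
  Module.Dual.transpose ∘ₗ LinearMap.mul ℂ _ ∘ₗ Submodule.subtype _

lemma contraction_apply (l : homogeneousSubmodule (Fin m) ℂ 1)
    (φ : Module.Dual ℂ (MvPolynomial (Fin m) ℂ)) (p : MvPolynomial (Fin m) ℂ) :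
    contraction m l φ p = φ (l * p) := rfl

lemma commute_contraction (x y : homogeneousSubmodule (Fin m) ℂ 1) :
    Commute (contraction m x) (contraction m y) := by
  ext φ s
  simp only [LinearMap.comp_apply, Module.End.mul_apply, contraction_apply, mul_left_comm]

lemma homogeneousComponent_linear_mul (l : homogeneousSubmodule (Fin m) ℂ 1) (d : ℕ)
    (p : MvPolynomial (Fin m) ℂ) :
    homogeneousComponent (d + 1) (l.1 * p) = l.1 * homogeneousComponent d p := by
  have := DirectSum.coe_decompose_mul_add_of_left_mem (homogeneousSubmodule (Fin m) ℂ)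
    (i := 1) (j := d) (b := p) l.2
  rw [add_comm 1 d] at this
  rw [← decomposition.decompose'_apply, ← decomposition.decompose'_apply]
  exact this

lemma contraction_mem_inverseSystem (I : Ideal (MvPolynomial (Fin m) ℂ)) (d : ℕ)
    (l : homogeneousSubmodule (Fin m) ℂ 1) {φ : Module.Dual ℂ (MvPolynomial (Fin m) ℂ)}
    (hφ : φ ∈ inverseSystem I (d + 1)) : contraction m l φ ∈ inverseSystem I d := by
  refine (Submodule.mem_dualAnnihilator _).2 fun p hp => ?_
  refine (Submodule.mem_dualAnnihilator _).1 hφ _ ?_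
  change homogeneousComponent (d + 1) (l.1 * p) ∈ I
  rw [homogeneousComponent_linear_mul]
  exact I.mul_mem_left _ hp

lemma inverseSystem_le_bot (I : Ideal (MvPolynomial (Fin m) ℂ)) (d : ℕ) :
    inverseSystem I d ≤ inverseSystem ⊥ d := by
  refine Submodule.dualAnnihilator_anti fun p hp => ?_
  have : homogeneousComponent d p = 0 := hp
  change homogeneousComponent d p ∈ I
  rw [this]
  exact I.zero_mem

lemma eq_zero_of_forall_contraction_eq_zero (d : ℕ)
    {φ : Module.Dual ℂ (MvPolynomial (Fin m) ℂ)} (hφ : φ ∈ inverseSystem ⊥ (d + 1))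
    (h : ∀ l, contraction m l φ = 0) : φ = 0 := by
  ext s
  change φ (monomial s 1) = 0
  by_cases hs : s = 0
  · refine (Submodule.mem_dualAnnihilator _).1 hφ _ ?_
    change homogeneousComponent (d + 1) (monomial s 1) = 0
    rw [hs]
    exact homogeneousComponent_eq_zero _ _ (by simp)
  · obtain ⟨i, hi⟩ := Finsupp.ne_iff.1 hs
    have hX : monomial s (1 : ℂ) = X i * monomial (s - Finsupp.single i 1) 1 := by
      rw [X, monomial_mul, one_mul, add_tsub_cancel_of_le]
      exact Finsupp.single_le_iff.2 (Nat.one_le_iff_ne_zero.2 hi)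
    rw [hX]
    exact LinearMap.congr_fun (h ⟨X i, isHomogeneous_X ℂ i⟩) _

lemma finiteDimensional_homogeneousSubmodule (d : ℕ) :
    FiniteDimensional ℂ (homogeneousSubmodule (Fin m) ℂ d) :=
  Module.Finite.iff_fg.2 (homogeneousSubmodule_fg (Fin m) ℂ d)

lemma finiteDimensional_and_finrank_inverseSystem (I : Ideal (MvPolynomial (Fin m) ℂ)) (d : ℕ) :
    FiniteDimensional ℂ (inverseSystem I d) ∧
      Module.finrank ℂ (inverseSystem I d) = hilb m I d := by
  let N := Submodule.comap (homogeneousSubmodule (Fin m) ℂ d).subtype (I.restrictScalars ℂ)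
  let c : MvPolynomial (Fin m) ℂ →ₗ[ℂ] homogeneousSubmodule (Fin m) ℂ d :=
    (homogeneousComponent d).codRestrict _ (homogeneousComponent_mem d)
  let π := N.mkQ ∘ₗ c
  have hker : LinearMap.ker π = componentIn I d := by
    rw [LinearMap.ker_comp, Submodule.ker_mkQ]
    rfl
  have hsurj : Function.Surjective π := by
    refine (Submodule.mkQ_surjective N).comp fun p => ⟨p, Subtype.ext ?_⟩
    exact (homogeneousComponent_of_mem p.2).trans (if_pos rfl)
  have := finiteDimensional_homogeneousSubmodule (m := m) d
  rw [inverseSystem, ← hker, ← LinearMap.range_dualMap_eq_dualAnnihilator_ker,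
    LinearMap.finrank_range_of_inj (LinearMap.dualMap_injective_of_surjective hsurj),
    Subspace.dual_finrank_eq]
  exact ⟨inferInstance, rfl⟩

/-- Strict form of Macaulay's bound, for sums of multichoose coefficients. -/
theorem sum_multichoose_lt_hilb (I : Ideal (MvPolynomial (Fin m) ℂ)) (d : ℕ) (a : ℕ → ℕ)
    (ha : ∑ i ∈ Finset.range (d + 1), (a i).multichoose (i + 1) < hilb m I (d + 1)) :
    ∑ i ∈ Finset.range d, (a (i + 1)).multichoose (i + 1) < hilb m I d := by
  obtain ⟨hfin, hrank⟩ := finiteDimensional_and_finrank_inverseSystem I d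
  obtain ⟨hfin', hrank'⟩ := finiteDimensional_and_finrank_inverseSystem I (d + 1)
  rw [← hrank'] at ha
  rw [← hrank]
  have := finiteDimensional_homogeneousSubmodule (m := m) 1
  refine (sum_multichoose_lt_finrank_shadow commute_contraction
    (fun e l φ hφ => contraction_mem_inverseSystem ⊥ e l hφ)
    (fun e φ hφ h => eq_zero_of_forall_contraction_eq_zero e hφ h) ⊥ d (inverseSystem I (d + 1))
    (inverseSystem_le_bot I _) ?_ a ha).trans_le (Submodule.finrank_mono ?_)
  · rintro z hz φ -
    rw [(Submodule.mem_bot ℂ).1 hz, map_zero]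
    rfl
  · exact Submodule.map₂_le.2 fun l _ φ hφ => contraction_mem_inverseSystem I d l hφ

end Hilbert

lemma macaulayTerm_succ_eq_multichoose (i : ℕ) {e : ℤ} (he : -1 ≤ e) :
    macaulayTerm (i + 1) e = (e + 1).toNat.multichoose (i + 1) := by
  rw [macaulayTerm, Nat.multichoose_eq]
  congr 1
  omega

/-- Macaulay's bound for sums of multichoose coefficients. -/
theorem sum_multichoose_le_hilb {m : ℕ} (I : Ideal (MvPolynomial (Fin m) ℂ)) (d : ℕ) (a : ℕ → ℕ)
    (ha : hilb m I (d + 1) = ∑ i ∈ Finset.range (d + 1), (a i).multichoose (i + 1)) :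
    ∑ i ∈ Finset.range d, (a (i + 1)).multichoose (i + 1) + (if a 0 = 0 then 0 else 1) ≤
      hilb m I d := by
  by_cases h0 : ∑ i ∈ Finset.range (d + 1), (a i).multichoose (i + 1) = 0
  · have hz : ∀ i ≤ d, a i = 0 := fun i hi => eq_zero_of_multichoose_eq_zero
      (Finset.sum_eq_zero_iff.1 h0 i (Finset.mem_range.2 (Nat.lt_succ_of_le hi)))
    rw [if_pos (hz 0 d.zero_le), Finset.sum_eq_zero fun i hi => by
      rw [hz (i + 1) (Finset.mem_range.1 hi), Nat.multichoose_zero_succ]]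
    exact Nat.zero_le _
  · obtain ⟨b, hb, hb'⟩ := exists_sum_multichoose_add_one_eq a d h0
    have := sum_multichoose_lt_hilb I d b (by omega)
    omega

end MacaulayBound

/-- if `I ⊆ ℂ[x_0,…,x_n]` is a homogeneous ideal, `d ≥ 2`, and
`c := h_I(d)` has Macaulay expansion `∑ binom(i + ε_i, i)` in base `d`, then
`h_I(d-1) ≥ c_{*d} := ∑_{i=2}^d binom(i + ε_i - 1, i - 1)`, with strict inequality
when `ε_1 ≥ 0`. -/
theorem hilb_pred_ge_macaulay_star (n d : ℕ) (hd : 2 ≤ d)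
    (I : Ideal (MvPolynomial (Fin (n + 1)) ℂ))
    (hI : I.IsHomogeneous (homogeneousSubmodule (Fin (n + 1)) ℂ))
    (ε : Fin d → ℤ) (hε : IsMacaulayExpansion d (hilb (n + 1) I d) ε) :
    (∑ i : Fin d, if 1 ≤ i.1 then macaulayTerm i.1 (ε i) else 0) ≤ hilb (n + 1) I (d - 1) ∧
    (0 ≤ ε ⟨0, by omega⟩ →
      (∑ i : Fin d, if 1 ≤ i.1 then macaulayTerm i.1 (ε i) else 0) < hilb (n + 1) I (d - 1)) := by
  obtain ⟨d, rfl⟩ : ∃ k, d = k + 1 := ⟨d - 1, by omega⟩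
  obtain ⟨-, hge, hsum⟩ := hε
  let a : ℕ → ℕ := fun i => if h : i < d + 1 then (ε ⟨i, h⟩ + 1).toNat else 0
  have ha : ∀ i : Fin (d + 1), (ε i + 1).toNat = a i := fun i => by
    simp only [a, dif_pos i.2, Fin.eta]
  have hc : hilb (n + 1) I (d + 1) =
      ∑ i ∈ Finset.range (d + 1), (a i).multichoose (i + 1) := by
    rw [hsum, ← Fin.sum_univ_eq_sum_range (fun i => (a i).multichoose (i + 1))]
    exact Finset.sum_congr rfl fun i _ => by
      rw [MacaulayBound.macaulayTerm_succ_eq_multichoose _ (hge i), ha]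
  have hstar : (∑ i : Fin (d + 1), if 1 ≤ i.1 then macaulayTerm i.1 (ε i) else 0) =
      ∑ i ∈ Finset.range d, (a (i + 1)).multichoose (i + 1) := by
    rw [Fin.sum_univ_succ, ← Fin.sum_univ_eq_sum_range (fun i => (a (i + 1)).multichoose (i + 1))]
    rw [if_neg (by simp), zero_add]
    simp only [Fin.val_succ, Nat.le_add_left, if_true]
    exact Finset.sum_congr rfl fun i _ => by
      rw [MacaulayBound.macaulayTerm_succ_eq_multichoose _ (hge _), ha, Fin.val_succ]
  have key := MacaulayBound.sum_multichoose_le_hilb I d a hc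
  rw [hstar, Nat.add_sub_cancel]
  refine ⟨(Nat.le_add_right _ _).trans key, fun h => ?_⟩
  have h0 : a 0 ≠ 0 := by
    have h1 : (ε 0 + 1).toNat = a 0 := ha 0
    have h2 : 0 ≤ ε 0 := h
    omega
  rw [if_neg h0] at key
  exact key
end

section
/- Let I ⊂ S = C[x_0,...,x_n] be a homogeneous ideal and d a positive integer such that h_I(d) ≤ d and the linear system I_{d+1} is base point free. Then for all k ≥ d, either h_I(k+1) < h_I(k) or h_I(k) = 0. -/
open MvPolynomial

attribute [local instance] MvPolynomial.gradedAlgebra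

open Submodule in
theorem le_span_setOf_mul_le {𝕜 A : Type*} [Field 𝕜] [Infinite 𝕜] [CommRing A] [Algebra 𝕜 A]
    {V K : Submodule 𝕜 A} [FiniteDimensional 𝕜 V] [FiniteDimensional 𝕜 K] {h : A} (hh : h ∈ V)
    (hV : V * K ≤ span 𝕜 {h} * K) :
    V ≤ span 𝕜 {g | g ∈ V ∧ V * K ≤ span 𝕜 {g} * K} := by
  intro x hx
  have : FiniteDimensional 𝕜 ↥(V * K) := Module.Finite.iff_fg.2
    ((Module.Finite.iff_fg.1 ‹_›).mul (Module.Finite.iff_fg.1 ‹_›))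
  let L (y : A) (hy : y ∈ V) : K →ₗ[𝕜] ↥(V * K) :=
    ((LinearMap.mulLeft 𝕜 y).comp K.subtype).codRestrict _ fun v => mul_mem_mul hy v.2
  have hsurj : Function.Surjective (L h hh) := by
    rintro ⟨w, hw⟩
    obtain ⟨z, hz, rfl⟩ := mem_span_singleton_mul.1 (hV hw)
    exact ⟨⟨z, hz⟩, rfl⟩
  obtain ⟨s, hs⟩ := (L h hh).exists_rightInverse_of_surjective (LinearMap.range_eq_top.2 hsurj)
  obtain ⟨μ, hμ⟩ : ∃ μ, ¬ Module.End.HasEigenvalue ((L x hx).comp s) μ := by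
    by_contra hall
    push Not at hall
    refine (LinearMap.charpoly_monic ((L x hx).comp s)).ne_zero (Polynomial.funext fun μ => ?_)
    simpa using (Module.End.hasEigenvalue_iff_isRoot_charpoly _ _).1 (hall μ)
  have hinj : Function.Injective ((L x hx).comp s - μ • (1 : Module.End 𝕜 ↥(V * K))) := by
    rw [← LinearMap.ker_eq_bot]
    simpa [Module.End.hasEigenvalue_iff, Module.End.eigenspace_def] using hμ
  have hsurj' := LinearMap.surjective_of_injective hinj
  have hg : x - μ • h ∈ V := V.sub_mem hx (V.smul_mem _ hh)
  have hgood : V * K ≤ span 𝕜 {x - μ • h} * K := by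
    intro w hw
    obtain ⟨u, hu⟩ := hsurj' ⟨w, hw⟩
    refine mem_span_singleton_mul.2 ⟨s u, (s u).2, ?_⟩
    have h1 : h * (s u : A) = u := congrArg Subtype.val (LinearMap.congr_fun hs u)
    have h2 := congrArg Subtype.val hu
    have h3 : x * (s u : A) - μ • (u : A) = w := h2
    rw [sub_mul, smul_mul_assoc, h1, h3]
  have := add_mem (subset_span (R := 𝕜) (s := {g | g ∈ V ∧ V * K ≤ span 𝕜 {g} * K}) ⟨hg, hgood⟩)
    (smul_mem _ μ (subset_span ⟨hh, hV⟩))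
  simpa using this

open Submodule in
/-- If `f * V ^ d` has dimension at most `d`, then `f * V ^ d = g * (f * V ^ (d - 1))` for
elements `g` spanning `V`: Green's hyperplane restriction theorem for small values of the
Hilbert function. -/
theorem le_span_setOf_pow_le {𝕜 A : Type*} [Field 𝕜] [Infinite 𝕜] [CommRing A] [Algebra 𝕜 A]
    (V : Submodule 𝕜 A) [FiniteDimensional 𝕜 V] (d : ℕ) (f : A)
    (hf : Module.finrank 𝕜 ↥(span 𝕜 {f} * V ^ d) ≤ d) :
    V ≤ span 𝕜 {g | g ∈ V ∧ span 𝕜 {f} * V ^ d ≤ span 𝕜 {g} * (span 𝕜 {f} * V ^ (d - 1))} := by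
  have fd (d : ℕ) (f : A) : FiniteDimensional 𝕜 ↥(span 𝕜 {f} * V ^ d) := Module.Finite.iff_fg.2
    ((fg_span_singleton f).mul ((Module.Finite.iff_fg.1 ‹_›).pow d))
  induction d generalizing f with
  | zero =>
    have h0 : span 𝕜 {f} * V ^ 0 = ⊥ := by
      have := fd 0 f
      exact finrank_eq_zero.1 (Nat.le_zero.1 hf)
    intro x hx
    exact subset_span ⟨hx, by rw [h0]; exact bot_le⟩
  | succ d ih =>
    have := fd d f
    have := fd (d + 1) f
    have hfac : span 𝕜 {f} * V ^ (d + 1) = V * (span 𝕜 {f} * V ^ d) := by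
      rw [pow_succ]; ring
    rw [Nat.add_sub_cancel]
    suffices ∃ h ∈ V, V * (span 𝕜 {f} * V ^ d) ≤ span 𝕜 {h} * (span 𝕜 {f} * V ^ d) by
      obtain ⟨h, hh, hle⟩ := this
      rw [hfac]
      exact le_span_setOf_mul_le hh hle
    by_contra! hno
    have hlt (h : A) (hh : h ∈ V) :
        Module.finrank 𝕜 ↥(span 𝕜 {h} * (span 𝕜 {f} * V ^ d)) < d + 1 := by
      refine lt_of_lt_of_le ?_ hf
      have hle : span 𝕜 {h} * (span 𝕜 {f} * V ^ d) ≤ span 𝕜 {f} * V ^ (d + 1) := by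
        rw [hfac]
        exact mul_le_mul_left (span_le.2 (by simpa using hh)) _
      refine finrank_lt_finrank_of_lt (lt_of_le_of_ne hle fun he => hno h hh ?_)
      rw [← hfac, he]
    obtain ⟨h, hh, hmax⟩ : ∃ h ∈ V, ∀ g ∈ V,
        Module.finrank 𝕜 ↥(span 𝕜 {g} * (span 𝕜 {f} * V ^ d)) ≤
          Module.finrank 𝕜 ↥(span 𝕜 {h} * (span 𝕜 {f} * V ^ d)) := by
      have hfin : Set.Finite ((fun g : A => Module.finrank 𝕜 ↥(span 𝕜 {g} * (span 𝕜 {f} * V ^ d))) ''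
          (V : Set A)) := (Set.finite_lt_nat (d + 1)).subset (by rintro _ ⟨g, hg, rfl⟩; exact hlt g hg)
      obtain ⟨h, hh, hm⟩ := Set.exists_max_image _ id hfin (Set.Nonempty.image _ ⟨0, V.zero_mem⟩)
      obtain ⟨h, hh, rfl⟩ := hh
      exact ⟨h, hh, fun g hg => hm _ ⟨g, hg, rfl⟩⟩
    have hspan : span 𝕜 {h * f} = span 𝕜 {h} * span 𝕜 {f} := by
      rw [span_mul_span, Set.singleton_mul_singleton]
    have hih := ih (h * f) (by
      rw [hspan, mul_assoc]
      exact Nat.lt_succ_iff.1 (hlt h hh))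
    have hT : V ≤ comap (LinearMap.mul 𝕜 A)
        (compatibleMaps (span 𝕜 {f} * V ^ d) (span 𝕜 {h} * (span 𝕜 {f} * V ^ d))) := by
      refine hih.trans (span_le.2 ?_)
      rintro g ⟨hg, hle⟩
      have hle' : span 𝕜 {h} * (span 𝕜 {f} * V ^ d) ≤ span 𝕜 {g} * (span 𝕜 {f} * V ^ d) := by
        rcases d with _ | d
        · have := fd 0 (h * f)
          have h0 := Nat.lt_one_iff.1 (hlt h hh)
          rw [← mul_assoc, ← hspan] at h0 ⊢
          rw [finrank_eq_zero.1 h0]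
          exact bot_le
        · rw [hspan, mul_assoc] at hle
          refine hle.trans ?_
          rw [Nat.add_sub_cancel, pow_succ]
          refine mul_le_mul_right ?_ _
          calc span 𝕜 {h} * span 𝕜 {f} * V ^ d ≤ V * span 𝕜 {f} * V ^ d :=
                mul_le_mul_left (mul_le_mul_left (span_le.2 (by simpa using hh)) _) _
            _ = _ := by ring
      have := fd d f
      have : Module.Finite 𝕜 ↥(span 𝕜 {g} * (span 𝕜 {f} * V ^ d)) := by
        rw [← mul_assoc, span_mul_span, Set.singleton_mul_singleton]; exact fd d _
      have heq := eq_of_le_of_finrank_le hle' (hmax g hg)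
      intro v hv
      rw [heq]
      exact mem_span_singleton_mul.2 ⟨v, hv, rfl⟩
    refine hno h hh (mul_le.2 fun g hg v hv => hT hg hv)

theorem nonempty_algHom_of_finiteDimensional (𝕜 B : Type*) [Field 𝕜] [IsAlgClosed 𝕜] [CommRing B]
    [Algebra 𝕜 B] [Nontrivial B] [FiniteDimensional 𝕜 B] : Nonempty (B →ₐ[𝕜] 𝕜) := by
  obtain ⟨m, hm⟩ := Ideal.exists_maximal B
  have h : Function.Bijective (Algebra.ofId 𝕜 (B ⧸ m)) :=
    IsAlgClosed.algebraMap_bijective_of_isIntegral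
  exact ⟨(AlgEquiv.ofBijective _ h).symm.toAlgHom.comp (Ideal.Quotient.mkₐ 𝕜 m)⟩

open scoped IsMulCommutative in
/-- Commuting endomorphisms have a joint spectral point: there is a point at which every polynomial
relation between them vanishes. -/
theorem exists_eval_eq_zero_of_commute {𝕜 W ι : Type*} [Field 𝕜] [IsAlgClosed 𝕜] [AddCommGroup W]
    [Module 𝕜 W] [FiniteDimensional 𝕜 W] [Nontrivial W] (M : ι → Module.End 𝕜 W)
    (hM : ∀ i j, M i * M j = M j * M i) :
    ∃ (Φ : MvPolynomial ι 𝕜 →ₐ[𝕜] Module.End 𝕜 W) (a : ι → 𝕜),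
      (∀ i, Φ (X i) = M i) ∧ ∀ p, Φ p = 0 → eval a p = 0 := by
  have := Algebra.isMulCommutative_adjoin 𝕜 (s := Set.range M)
    (by rintro _ ⟨i, rfl⟩ _ ⟨j, rfl⟩; exact hM i j)
  let B := Algebra.adjoin 𝕜 (Set.range M)
  have : FiniteDimensional 𝕜 B := inferInstance
  obtain ⟨χ⟩ := nonempty_algHom_of_finiteDimensional 𝕜 B
  let b (i : ι) : B := ⟨M i, Algebra.subset_adjoin ⟨i, rfl⟩⟩
  refine ⟨B.val.comp (aeval b), fun i => χ (b i), fun i => by simp [b], fun p hp => ?_⟩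
  have h0 : aeval b p = 0 := Subtype.val_injective hp
  have h1 : aeval (fun i => χ (b i)) p = χ (aeval b p) := by
    rw [← MvPolynomial.comp_aeval_apply]
  rw [h0, map_zero] at h1
  rwa [← coe_aeval_eq_eval]

open Submodule in
theorem map_aeval_homogeneousSubmodule {𝕜 A ι : Type*} [Field 𝕜] [CommRing A] [Algebra 𝕜 A]
    (x : ι → A) (k : ℕ) :
    (homogeneousSubmodule ι 𝕜 k).map (aeval x).toLinearMap = span 𝕜 (Set.range x) ^ k := by
  rw [← homogeneousSubmodule_one_pow, homogeneousSubmodule_one_eq_span_X, Submodule.map_pow,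
    map_span, ← Set.range_comp]
  congr 3
  ext i
  simp

open Submodule in
/-- If multiplication by `ℓ` is injective on `V ^ (m + 1) = ℓ * V ^ m`, where `V` is spanned by the
`x i`, then the relations of degree `m + 2` between the `x i` have a common zero. -/
theorem exists_common_zero {𝕜 A ι : Type*} [Field 𝕜] [IsAlgClosed 𝕜] [CommRing A] [Algebra 𝕜 A]
    [Finite ι] (x : ι → A) (m : ℕ) {ℓ : A} (hℓ : ℓ ∈ span 𝕜 (Set.range x))
    (hsurj : span 𝕜 (Set.range x) ^ (m + 1) ≤ span 𝕜 {ℓ} * span 𝕜 (Set.range x) ^ m)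
    (hinj : ∀ v ∈ span 𝕜 (Set.range x) ^ (m + 1), ℓ * v = 0 → v = 0)
    (hne : span 𝕜 (Set.range x) ^ (m + 1) ≠ ⊥) :
    ∃ a : ι → 𝕜, a ≠ 0 ∧ ∀ g : MvPolynomial ι 𝕜, g.IsHomogeneous (m + 2) → aeval x g = 0 →
      eval a g = 0 := by
  set V := span 𝕜 (Set.range x) with hVdef
  have hx (i : ι) : x i ∈ V := subset_span ⟨i, rfl⟩
  have hV : V.FG := fg_span (Set.finite_range x)
  have : FiniteDimensional 𝕜 ↥(V ^ (m + 1)) := Module.Finite.iff_fg.2 (hV.pow _)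
  have : Nontrivial ↥(V ^ (m + 1)) := nontrivial_iff_ne_bot.2 hne
  let L : ↥(V ^ (m + 1)) →ₗ[𝕜] A := (LinearMap.mulLeft 𝕜 ℓ).comp (V ^ (m + 1)).subtype
  have hL : Function.Injective L := by
    rw [injective_iff_map_eq_zero]
    exact fun v hv => Subtype.ext (hinj v v.2 hv)
  let e := LinearEquiv.ofInjective L hL
  have hmem (i : ι) (v : ↥(V ^ (m + 1))) : x i * v ∈ LinearMap.range L := by
    obtain ⟨u, hu, huv⟩ := mem_span_singleton_mul.1 (hsurj v.2)
    refine ⟨⟨x i * u, ?_⟩, ?_⟩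
    · rw [pow_succ']; exact mul_mem_mul (hx i) hu
    · change ℓ * (x i * u) = _
      rw [← huv]; ring
  let M (i : ι) : Module.End 𝕜 ↥(V ^ (m + 1)) := e.symm.toLinearMap.comp
    (((LinearMap.mulLeft 𝕜 (x i)).comp (V ^ (m + 1)).subtype).codRestrict _ (hmem i))
  have hMx (i : ι) (v : ↥(V ^ (m + 1))) : ℓ * (M i v : A) = x i * v :=
    congrArg Subtype.val (e.apply_symm_apply ⟨x i * v, hmem i v⟩)
  have hcancel {v w : A} (hv : v ∈ V ^ (m + 1)) (hw : w ∈ V ^ (m + 1)) (h : ℓ * v = ℓ * w) :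
      v = w := congrArg Subtype.val (@hL ⟨v, hv⟩ ⟨w, hw⟩ h)
  have hMu (i : ι) (v : ↥(V ^ (m + 1))) (u : A) (hu : u ∈ V ^ m) (hv : (v : A) = ℓ * u) :
      (M i v : A) = x i * u := by
    refine hcancel (M i v).2 (by rw [pow_succ']; exact mul_mem_mul (hx i) hu) ?_
    rw [hMx, hv]; ring
  obtain ⟨Φ, a, hΦ, ha⟩ := exists_eval_eq_zero_of_commute M fun i j => by
    ext v
    obtain ⟨u, hu, huv⟩ := mem_span_singleton_mul.1 (hsurj v.2)
    refine hcancel (M i (M j v)).2 (M j (M i v)).2 ?_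
    rw [Module.End.mul_apply, Module.End.mul_apply, hMx, hMx, hMu i v u hu huv.symm, hMu j v u hu huv.symm]; ring
  have hΦx (p : MvPolynomial ι 𝕜) (hp : p ∈ homogeneousSubmodule ι 𝕜 1) (v : ↥(V ^ (m + 1))) :
      ℓ * (Φ p v : A) = aeval x p * v := by
    rw [homogeneousSubmodule_one_eq_span_X] at hp
    induction hp using span_induction with
    | mem p hp => obtain ⟨i, rfl⟩ := hp; rw [hΦ, hMx, aeval_X]
    | zero => simp
    | add p q _ _ hp hq => simp [mul_add, add_mul, hp, hq]
    | smul c p _ hp => simp [hp]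
  have haeval (k : ℕ) (p : MvPolynomial ι 𝕜) (hp : p ∈ homogeneousSubmodule ι 𝕜 k) :
      aeval x p ∈ V ^ k := by
    rw [hVdef, ← map_aeval_homogeneousSubmodule]; exact mem_map_of_mem hp
  have hlift (k : ℕ) (w : A) (hw : w ∈ V ^ k) :
      ∃ p ∈ homogeneousSubmodule ι 𝕜 k, aeval x p = w := by
    rwa [hVdef, ← map_aeval_homogeneousSubmodule] at hw
  have hpow (j : ℕ) (p : MvPolynomial ι 𝕜) (hp : p ∈ homogeneousSubmodule ι 𝕜 j) :
      ∀ i, i + j = m + 1 → ∀ u ∈ V ^ i, ∀ v : ↥(V ^ (m + 1)), (v : A) = ℓ ^ j * u →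
        (Φ p v : A) = aeval x p * u := by
    induction j generalizing p with
    | zero =>
      intro i _ u _ v hv
      rw [homogeneousSubmodule_zero] at hp
      obtain ⟨c, rfl⟩ := mem_one.1 hp
      simp [hv, ← Algebra.smul_def, MvPolynomial.algebraMap_eq]
    | succ j ih =>
      intro i hij u hu v hv
      rw [← homogeneousSubmodule_one_pow, pow_succ', homogeneousSubmodule_one_pow] at hp
      induction hp using Submodule.mul_induction_on' with
      | mem_mul_mem p hp q hq =>
        have h1 := ih q hq (i + 1) (by omega) (ℓ * u) (by rw [pow_succ']; exact mul_mem_mul hℓ hu)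
          v (by rw [hv]; ring)
        have hw : aeval x q * u ∈ V ^ m := by
          rw [show m = j + i by omega, pow_add]; exact mul_mem_mul (haeval j q hq) hu
        refine hcancel (Φ (p * q) v).2 ?_ ?_
        · rw [map_mul, mul_assoc, pow_succ']
          exact mul_mem_mul (by simpa using haeval 1 p hp) hw
        · rw [map_mul, Module.End.mul_apply, hΦx p hp, h1, map_mul]; ring
      | add p _ q _ hp hq => simp [add_mul, hp, hq]
  let v₀ : ↥(V ^ (m + 1)) := ⟨ℓ ^ (m + 1), pow_mem_pow _ hℓ _⟩
  have hv₀ (p : MvPolynomial ι 𝕜) (hp : p ∈ homogeneousSubmodule ι 𝕜 (m + 1)) :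
      (Φ p v₀ : A) = aeval x p := by
    simpa using hpow (m + 1) p hp 0 (by omega) 1 (by rw [pow_zero]; exact mem_one.2 ⟨1, map_one _⟩) v₀ (by simp [v₀])
  have hv₀' (g : MvPolynomial ι 𝕜) (hg : g ∈ homogeneousSubmodule ι 𝕜 (m + 2)) :
      ℓ * (Φ g v₀ : A) = aeval x g := by
    rw [← homogeneousSubmodule_one_pow, pow_succ', homogeneousSubmodule_one_pow] at hg
    induction hg using Submodule.mul_induction_on' with
    | mem_mul_mem p hp q hq =>
      rw [map_mul, Module.End.mul_apply, hΦx p hp, hv₀ q hq, map_mul]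
    | add p _ q _ hp hq => simp [mul_add, hp, hq]
  refine ⟨a, ?_, fun g hg hg0 => ha g ?_⟩
  · rintro rfl
    obtain ⟨p, hp, hpℓ⟩ : ∃ p ∈ homogeneousSubmodule ι 𝕜 1, aeval x p = ℓ :=
      hlift 1 ℓ (by rwa [pow_one])
    have h1 : Φ (p - 1) = 0 := by
      rw [map_sub, map_one, sub_eq_zero]
      ext v
      refine hcancel (Φ p v).2 v.2 ?_
      rw [hΦx p hp, hpℓ, Module.End.one_apply]
    have h2 := ha _ h1
    have h3 : eval (0 : ι → 𝕜) p = 0 := by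
      rw [eval_zero, constantCoeff_eq]
      exact IsHomogeneous.coeff_eq_zero hp (by simp)
    rw [map_sub, h3, map_one, zero_sub] at h2
    exact one_ne_zero (neg_eq_zero.1 h2)
  · ext v
    obtain ⟨p, hp, hpv⟩ := hlift (m + 1) v v.2
    have hv : v = Φ p v₀ := Subtype.ext (by rw [hv₀ p hp, hpv])
    have hg₀ : Φ g v₀ = 0 := Subtype.ext (hinj _ (Φ g v₀).2 (by rw [hv₀' g hg, hg0]))
    rw [hv, ← Module.End.mul_apply, ← map_mul, mul_comm, map_mul, Module.End.mul_apply, hg₀]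
    simp

open Submodule in
theorem eq_zero_of_mul_eq_zero_of_finrank_le {𝕜 A : Type*} [Field 𝕜] [CommRing A] [Algebra 𝕜 A]
    {V : Submodule 𝕜 A} [FiniteDimensional 𝕜 V] {ℓ : A} {k : ℕ} (hℓ : ℓ ∈ V)
    (hsurj : V ^ (k + 1) ≤ span 𝕜 {ℓ} * V ^ k)
    (hle : Module.finrank 𝕜 ↥(V ^ (k + 1)) ≤ Module.finrank 𝕜 ↥(V ^ (k + 1 + 1))) :
    ∀ v ∈ V ^ (k + 1), ℓ * v = 0 → v = 0 := by
  have fd (j : ℕ) : FiniteDimensional 𝕜 ↥(V ^ j) :=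
    Module.Finite.iff_fg.2 ((Module.Finite.iff_fg.1 ‹_›).pow j)
  have hle' : V ^ (k + 1 + 1) ≤ span 𝕜 {ℓ} * V ^ (k + 1) :=
    calc V ^ (k + 1 + 1) = V ^ (k + 1) * V := pow_succ _ _
      _ ≤ span 𝕜 {ℓ} * V ^ k * V := mul_le_mul_left hsurj _
      _ = _ := by rw [mul_assoc, ← pow_succ]
  let L : ↥(V ^ (k + 1)) →ₗ[𝕜] ↥(V ^ (k + 1 + 1)) :=
    ((LinearMap.mulLeft 𝕜 ℓ).comp (V ^ (k + 1)).subtype).codRestrict _ fun v => by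
      rw [pow_succ' V (k + 1)]; exact mul_mem_mul hℓ v.2
  have hL : Function.Surjective L := by
    rintro ⟨w, hw⟩
    obtain ⟨z, hz, rfl⟩ := mem_span_singleton_mul.1 (hle' hw)
    exact ⟨⟨z, hz⟩, rfl⟩
  have hinj := (LinearMap.injective_iff_surjective_of_finrank_eq_finrank
    (hle.antisymm (LinearMap.finrank_le_finrank_of_surjective hL))).2 hL
  intro v hv h0
  have : (⟨v, hv⟩ : ↥(V ^ (k + 1))) = 0 :=
    (injective_iff_map_eq_zero L).1 hinj _ (Subtype.ext h0)
  exact congrArg Subtype.val this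

theorem Submodule.pow_succ_eq_bot {𝕜 A : Type*} [Field 𝕜] [CommRing A] [Algebra 𝕜 A]
    {V : Submodule 𝕜 A} {k : ℕ} (h : V ^ k = ⊥) : V ^ (k + 1) = ⊥ := by
  rw [pow_succ, h, bot_mul]

open Submodule in
theorem hilb_eq_finrank_pow (m : ℕ) (I : Ideal (MvPolynomial (Fin m) ℂ)) (k : ℕ) :
    hilb m I k = Module.finrank ℂ
      ↥(span ℂ (Set.range fun i : Fin m => Ideal.Quotient.mk I (X i)) ^ k) := by
  have haeval : aeval (fun i : Fin m => Ideal.Quotient.mk I (X i)) = Ideal.Quotient.mkₐ ℂ I :=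
    algHom_ext fun i => by simp
  let F := (Ideal.Quotient.mkₐ ℂ I).toLinearMap.comp (homogeneousSubmodule (Fin m) ℂ k).subtype
  have hker : comap (homogeneousSubmodule (Fin m) ℂ k).subtype (restrictScalars ℂ I) = F.ker := by
    ext p
    simp [F, Ideal.Quotient.eq_zero_iff_mem]
  have hrange : F.range = span ℂ (Set.range fun i : Fin m => Ideal.Quotient.mk I (X i)) ^ k := by
    rw [← map_aeval_homogeneousSubmodule, haeval, LinearMap.range_comp, range_subtype]
  rw [hilb, ← hrange, hker]
  exact F.quotKerEquivRange.finrank_eq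

open Submodule in
theorem hilb_succ_eq_zero {m k : ℕ} {I : Ideal (MvPolynomial (Fin m) ℂ)} (h : hilb m I k = 0) :
    hilb m I (k + 1) = 0 := by
  rw [hilb_eq_finrank_pow] at h ⊢
  have : FiniteDimensional ℂ
      ↥(span ℂ (Set.range fun i : Fin m => Ideal.Quotient.mk I (X i)) ^ k) :=
    Module.Finite.iff_fg.2 ((fg_span (Set.finite_range _)).pow k)
  rw [pow_succ_eq_bot (finrank_eq_zero.1 h), finrank_bot]

open Submodule in
theorem hilb_succ_lt_or_eq_zero {m k : ℕ} (hk : 0 < k) (I : Ideal (MvPolynomial (Fin m) ℂ))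
    (hc : hilb m I k ≤ k)
    (hbpf : ∀ x : Fin m → ℂ, x ≠ 0 → ∃ g ∈ I, g.IsHomogeneous (k + 1) ∧ eval x g ≠ 0) :
    hilb m I (k + 1) < hilb m I k ∨ hilb m I k = 0 := by
  obtain ⟨k, rfl⟩ := Nat.exists_eq_succ_of_ne_zero hk.ne'
  rw [Nat.succ_eq_add_one] at *
  rw [hilb_eq_finrank_pow] at hc ⊢
  rw [hilb_eq_finrank_pow]
  set x := fun i : Fin m => Ideal.Quotient.mk I (X i) with hxdef
  have haeval : aeval x = Ideal.Quotient.mkₐ ℂ I := algHom_ext fun i => by simp [hxdef]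
  have hfg : (span ℂ (Set.range x)).FG := fg_span (Set.finite_range x)
  have (j : ℕ) : FiniteDimensional ℂ ↥(span ℂ (Set.range x) ^ j) :=
    Module.Finite.iff_fg.2 (hfg.pow j)
  have : FiniteDimensional ℂ ↥(span ℂ (Set.range x)) := Module.Finite.iff_fg.2 hfg
  by_contra! hcon
  obtain ⟨hle, hne⟩ := hcon
  have hne' : span ℂ (Set.range x) ^ (k + 1) ≠ ⊥ := fun h => hne (finrank_eq_zero.2 h)
  have hspan := le_span_setOf_pow_le (span ℂ (Set.range x)) (k + 1) 1
    (by rwa [← one_eq_span, one_mul])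
  rw [← one_eq_span, one_mul, one_mul, Nat.add_sub_cancel] at hspan
  obtain ⟨ℓ, hℓ, hsurj⟩ : ∃ ℓ ∈ span ℂ (Set.range x),
      span ℂ (Set.range x) ^ (k + 1) ≤ span ℂ {ℓ} * span ℂ (Set.range x) ^ k := by
    by_contra! hno
    rw [Set.eq_empty_of_forall_notMem (s := {g | _}) fun g hg => hno g hg.1 hg.2, span_empty,
      le_bot_iff] at hspan
    exact hne' (by rw [hspan, bot_pow (Nat.succ_ne_zero k)])
  have hinj := eq_zero_of_mul_eq_zero_of_finrank_le hℓ hsurj hle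
  obtain ⟨a, ha, hzero⟩ := exists_common_zero x k hℓ hsurj hinj hne'
  obtain ⟨g, hgI, hg, hga⟩ := hbpf a ha
  exact hga (hzero g hg (by rw [haeval]; exact Ideal.Quotient.eq_zero_iff_mem.2 hgI))

/-- if `h_I(d) ≤ d` and the linear system `I_{d+1}` is base point free
(no nonzero common zero in `ℂ^{n+1}`, i.e. empty base locus in `ℙ^n`), then for every
`k ≥ d` either `h_I(k+1) < h_I(k)` or `h_I(k) = 0`. -/
theorem hilb_strictly_decreasing_of_basePointFree (n d : ℕ) (hd : 0 < d)
    (I : Ideal (MvPolynomial (Fin (n + 1)) ℂ))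
    (hI : I.IsHomogeneous (homogeneousSubmodule (Fin (n + 1)) ℂ))
    (hc : hilb (n + 1) I d ≤ d)
    (hbpf : ∀ x : Fin (n + 1) → ℂ, x ≠ 0 →
      ∃ g ∈ I, g.IsHomogeneous (d + 1) ∧ MvPolynomial.eval x g ≠ 0) :
    ∀ k, d ≤ k → hilb (n + 1) I (k + 1) < hilb (n + 1) I k ∨ hilb (n + 1) I k = 0 := by
  have key (k : ℕ) (hk : d ≤ k) (hck : hilb (n + 1) I k ≤ k) :
      hilb (n + 1) I (k + 1) < hilb (n + 1) I k ∨ hilb (n + 1) I k = 0 := by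
    refine hilb_succ_lt_or_eq_zero (hd.trans_le hk) I hck fun x hx => ?_
    obtain ⟨g, hgI, hg, hgx⟩ := hbpf x hx
    obtain ⟨i, hi⟩ := Function.ne_iff.1 hx
    refine ⟨X i ^ (k - d) * g, I.mul_mem_left _ hgI, ?_, ?_⟩
    · have := ((isHomogeneous_X ℂ i).pow (k - d)).mul hg
      rwa [show 1 * (k - d) + (d + 1) = k + 1 by omega] at this
    · simpa [hgx] using fun h => absurd h hi
  have hbound (k : ℕ) (hk : d ≤ k) : hilb (n + 1) I k ≤ k := by
    induction k, hk using Nat.le_induction with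
    | base => exact hc
    | succ k hk ih =>
      rcases key k hk ih with h | h
      · omega
      · rw [hilb_succ_eq_zero h]; omega
  exact fun k hk => key k hk (hbound k hk)
end

section
/- Let I ⊂ S = C[x_0,...,x_n] be a homogeneous ideal such that S/I is an Artinian Gorenstein ring with socle degree N. For each k with -1 ≤ k ≤ n-1, let d_k be the smallest integer t such that the base locus of I_t in P^n has dimension at most k. Then Σ_{k=-1}^{n-1} d_k ≥ N + n + 1. -/
open MvPolynomial

attribute [local instance] MvPolynomial.gradedAlgebra

/-- `S/I` is a graded Artinian Gorenstein quotient with socle degree `N`: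
`I` is homogeneous and proper, `I` contains everything of degree `> N`,
`dim_ℂ (S/I)_N = 1`, and the multiplication pairing
`(S/I)_a × (S/I)_{N-a} → (S/I)_N` is nondegenerate. -/
def IsArtinianGorenstein (m : ℕ) (I : Ideal (MvPolynomial (Fin m) ℂ)) (N : ℕ) : Prop :=
  I.IsHomogeneous (homogeneousSubmodule (Fin m) ℂ) ∧ I ≠ ⊤ ∧
  (∀ g : MvPolynomial (Fin m) ℂ, (∃ k, N < k ∧ g.IsHomogeneous k) → g ∈ I) ∧
  hilb m I N = 1 ∧
  (∀ a : ℕ, a ≤ N → ∀ g : MvPolynomial (Fin m) ℂ, g.IsHomogeneous a → g ∉ I →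
    ∃ h : MvPolynomial (Fin m) ℂ, h.IsHomogeneous (N - a) ∧ g * h ∉ I)

/-- The base locus of the linear system `I_t` in `ℙ^{m-1}` has dimension at most `k`:
the affine cone on it, cut out by the degree-`t` part of `I`, has Krull dimension
at most `k + 1`. -/
def BaseLocusDimLE (m : ℕ) (I : Ideal (MvPolynomial (Fin m) ℂ)) (t : ℕ) (k : ℤ) : Prop :=
  ringKrullDim
      (MvPolynomial (Fin m) ℂ ⧸ Ideal.span {g : MvPolynomial (Fin m) ℂ | g ∈ I ∧ g.IsHomogeneous t})
    ≤ ((k + 1).toNat : WithBot ℕ∞)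

/-- Given finitely many ideals of a Noetherian algebra over an infinite field, a linear subspace
which does not annihilate any nonzero element modulo any of the ideals contains an element which is
a nonzerodivisor modulo all of them. -/
theorem exists_mem_forall_regular_mod {F A ι : Type*} [Field F] [Infinite F] [CommRing A]
    [Algebra F A] [IsNoetherianRing A] [Finite ι] (K : ι → Ideal A) (W : Submodule F A)
    (hW : ∀ i, ∀ u ∉ K i, ∃ w ∈ W, w * u ∉ K i) :
    ∃ w ∈ W, ∀ i h, w * h ∈ K i → h ∈ K i := by
  have hfin : (associatedPrimes A (∀ i, A ⧸ K i)).Finite := associatedPrimes.finite A _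
  have : Finite (associatedPrimes A (∀ i, A ⧸ K i)) := hfin
  by_contra! hcon
  obtain ⟨⟨Q, hQ⟩, htop⟩ := Subspace.exists_eq_top_of_iUnion_eq_univ
    (p := fun Q : associatedPrimes A (∀ i, A ⧸ K i) =>
      (Q.1.restrictScalars F).comap W.subtype) (by
    refine Set.eq_univ_of_forall fun w => ?_
    obtain ⟨i, h, hmem, hnot⟩ := hcon w.1 w.2
    have hw : (w : A) ∈ ⋃ p ∈ associatedPrimes A (∀ i, A ⧸ K i), (p : Set A) := by
      rw [biUnion_associatedPrimes_eq_compl_regular, Set.mem_compl_iff, Set.mem_ofPred_eq,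
        isSMulRegular_iff_right_eq_zero_of_smul]
      classical
      intro hreg
      have := hreg (Pi.single i (Ideal.Quotient.mk (K i) h)) (by
        rw [← Pi.single_smul, Algebra.smul_def, Ideal.Quotient.algebraMap_eq, ← map_mul,
          Ideal.Quotient.eq_zero_iff_mem.mpr hmem, Pi.single_zero])
      rw [Pi.single_eq_zero_iff, Ideal.Quotient.eq_zero_iff_mem] at this
      exact hnot this
    simpa using hw)
  obtain ⟨hprime, x, rfl⟩ := isAssociatedPrime_iff.mp hQ
  have hx : x ≠ 0 := by
    rintro rfl
    exact hprime.ne_top (by simp)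
  obtain ⟨i, hi⟩ := Function.ne_iff.mp hx
  obtain ⟨u, hu⟩ := Ideal.Quotient.mk_surjective (x i)
  obtain ⟨w, hw, hwu⟩ := hW i u (fun h => hi (by
    rw [← hu, Ideal.Quotient.eq_zero_iff_mem.mpr h, Pi.zero_apply]))
  have hmem : (⟨w, hw⟩ : W) ∈ (((⊥ : Submodule A (∀ i, A ⧸ K i)).colon {x}).restrictScalars F).comap
      W.subtype := by
    simp only at htop
    rw [htop]; trivial
  have h0 : w • x = 0 := by simpa [Submodule.mem_colon_singleton] using hmem
  refine hwu (Ideal.Quotient.eq_zero_iff_mem.mp ?_)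
  have := congrFun h0 i
  rwa [Pi.smul_apply, ← hu, Algebra.smul_def, Ideal.Quotient.algebraMap_eq, ← map_mul] at this

section Graded

open DirectSum

variable {F A : Type*} [Field F] [CommRing A] [Algebra F A] (𝒜 : ℤ → Submodule F A)

/-- Modulo the ideal `J` there is a regular sequence of `r` homogeneous elements of positive
degrees `α₁, …, α_r` such that `J` and the sequence together contain all homogeneous elements of
degree greater than `s + α₁ + ⋯ + α_r`. -/
def HasRegularParameters : ℕ → ℤ → Ideal A → Prop
  | 0, s, J => ∀ k, s < k → ∀ g ∈ 𝒜 k, g ∈ J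
  | r + 1, s, J => ∃ α : ℤ, 0 < α ∧ ∃ c ∈ 𝒜 α, (∀ h, c * h ∈ J → h ∈ J) ∧
      HasRegularParameters r (s + α) (J ⊔ Ideal.span {c})

theorem isHomogeneous_sup_span_singleton [GradedAlgebra 𝒜] {J : Ideal A}
    (hJ : J.IsHomogeneous 𝒜) {e : ℤ} {f : A} (hf : f ∈ 𝒜 e) :
    (J ⊔ Ideal.span {f}).IsHomogeneous 𝒜 :=
  hJ.sup (Ideal.homogeneous_span 𝒜 _ (by rintro _ rfl; exact ⟨e, hf⟩))

theorem exists_sub_mul_mem_of_mem_sup_span_singleton [GradedAlgebra 𝒜] {J : Ideal A}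
    (hJ : J.IsHomogeneous 𝒜) {α k : ℤ} {a g : A} (ha : a ∈ 𝒜 α) (hg : g ∈ 𝒜 (α + k))
    (hmem : g ∈ J ⊔ Ideal.span {a}) : ∃ h ∈ 𝒜 k, g - a * h ∈ J := by
  obtain ⟨j, hj, b, hb, rfl⟩ := Submodule.mem_sup.mp hmem
  obtain ⟨h, rfl⟩ := Ideal.mem_span_singleton'.mp hb
  refine ⟨decompose 𝒜 h k, SetLike.coe_mem _, ?_⟩
  rw [← coe_decompose_mul_add_of_left_mem 𝒜 ha, ← decompose_of_mem_same 𝒜 hg, decompose_add,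
    mul_comm h a]
  simpa using hJ (α + k) hj

theorem exists_decompose_notMem [GradedAlgebra 𝒜] {J : Ideal A} {u : A} (hu : u ∉ J) :
    ∃ i, (decompose 𝒜 u i : A) ∉ J := by
  classical
  by_contra! hcon
  refine hu ?_
  rw [← sum_support_decompose 𝒜 u]
  exact J.sum_mem fun i _ => hcon i

/-- Dividing a homogeneous `u ∉ J` by a regular element `c` of positive degree as often as possible
gives an element outside `J + (c)` annihilated modulo `J` by everything that annihilates `u`. -/
theorem exists_notMem_sup_span_singleton [GradedAlgebra 𝒜] (hneg : ∀ k < 0, 𝒜 k = ⊥) {J : Ideal A}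
    (hJ : J.IsHomogeneous 𝒜) {α : ℤ} {c : A} (hα : 0 < α) (hc : c ∈ 𝒜 α)
    (hreg : ∀ h, c * h ∈ J → h ∈ J) (i : ℕ) :
    ∀ j : ℤ, j ≤ i → ∀ u ∈ 𝒜 j, u ∉ J →
      ∃ j', ∃ v ∈ 𝒜 j', v ∉ J ⊔ Ideal.span {c} ∧ ∀ g, g * u ∈ J → g * v ∈ J := by
  induction i with
  | zero =>
    intro j hj u hu huJ
    refine ⟨j, u, hu, fun hmem => ?_, fun g h => h⟩
    obtain ⟨h, hh, hsub⟩ := exists_sub_mul_mem_of_mem_sup_span_singleton 𝒜 hJ (k := j - α) hc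
      (by simpa using hu) hmem
    rw [hneg (j - α) (by push_cast at hj; omega), Submodule.mem_bot] at hh
    exact huJ (by simpa [hh] using hsub)
  | succ i ih =>
    intro j hj u hu huJ
    by_cases hmem : u ∈ J ⊔ Ideal.span {c}
    · obtain ⟨h, hh, hsub⟩ := exists_sub_mul_mem_of_mem_sup_span_singleton 𝒜 hJ (k := j - α) hc
        (by simpa using hu) hmem
      have hhJ : h ∉ J := fun hh' => huJ (by
        simpa using J.add_mem hsub (J.mul_mem_left c hh'))
      obtain ⟨j', v, hv, hvJ, hvu⟩ := ih (j - α) (by push_cast at hj; omega) h hh hhJ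
      refine ⟨j', v, hv, hvJ, fun g hg => hvu g (hreg _ ?_)⟩
      have : c * (g * h) = g * u - g * (u - c * h) := by ring
      rw [this]
      exact J.sub_mem hg (J.mul_mem_left g hsub)
    · exact ⟨j, u, hu, hmem, fun g h => h⟩

/-- The length of a regular sequence modulo `J` bounds from below the dimension of the quotient by
the annihilator of any homogeneous element which is nonzero modulo `J`. -/
theorem HasRegularParameters.le_ringKrullDim_quotient_colon [GradedAlgebra 𝒜]
    (hneg : ∀ k < 0, 𝒜 k = ⊥) {r : ℕ} {s : ℤ} {J : Ideal A} (hJ : J.IsHomogeneous 𝒜)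
    (h : HasRegularParameters 𝒜 r s J) {i : ℤ} {u : A} (hu : u ∈ 𝒜 i) (huJ : u ∉ J) :
    (r : WithBot ℕ∞) ≤ ringKrullDim (A ⧸ J.colon {u}) := by
  induction r generalizing s J i u with
  | zero =>
    have : Nontrivial (A ⧸ J.colon {u}) := by
      rw [Ideal.Quotient.nontrivial_iff]
      intro htop
      exact huJ (by simpa [Submodule.mem_colon_singleton] using
        (Ideal.eq_top_iff_one _).mp htop)
    simpa using ringKrullDim_nonneg_of_nontrivial
  | succ r ih =>
    obtain ⟨α, hα, c, hc, hreg, h⟩ := h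
    obtain ⟨j, v, hv, hvJ, hvu⟩ := exists_notMem_sup_span_singleton 𝒜 hneg hJ hα hc hreg
      i.toNat i (by omega) u hu huJ
    have hle : J.colon {u} ≤ (J ⊔ Ideal.span {c}).colon {v} := fun g hg => by
      rw [Submodule.mem_colon_singleton] at hg ⊢
      exact Submodule.mem_sup_left (hvu g hg)
    have hih := ih (isHomogeneous_sup_span_singleton 𝒜 hJ hc) h hv hvJ
    have hsucc := ringKrullDim_succ_le_of_surjective (Ideal.Quotient.factor hle)
      (Ideal.Quotient.factor_surjective hle) (r := Ideal.Quotient.mk _ c)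
      (by
        rw [mem_nonZeroDivisors_iff_right]
        intro x hx
        obtain ⟨x, rfl⟩ := Ideal.Quotient.mk_surjective x
        rw [← map_mul, Ideal.Quotient.eq_zero_iff_mem, Submodule.mem_colon_singleton,
          smul_eq_mul] at hx
        rw [Ideal.Quotient.eq_zero_iff_mem, Submodule.mem_colon_singleton, smul_eq_mul]
        exact hreg _ (by convert hx using 1; ring))
      (by
        rw [Ideal.Quotient.factor_mk, Ideal.Quotient.eq_zero_iff_mem,
          Submodule.mem_colon_singleton, smul_eq_mul]
        exact Ideal.mul_mem_right _ _
          (Submodule.mem_sup_right (Ideal.mem_span_singleton_self c)))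
    refine le_trans ?_ hsucc
    push_cast
    gcongr

/-- Elements of degree `t` generating an ideal of dimension less than the depth of `A ⧸ J` include
a nonzerodivisor modulo `J`. -/
theorem HasRegularParameters.exists_regular_of_ringKrullDim_le [GradedAlgebra 𝒜] [Infinite F]
    [IsNoetherianRing A] (hneg : ∀ k < 0, 𝒜 k = ⊥) {r : ℕ} {s : ℤ} {J : Ideal A}
    (hJ : J.IsHomogeneous 𝒜) (h : HasRegularParameters 𝒜 (r + 1) s J) {t : ℤ} {W : Submodule F A}
    (hWt : W ≤ 𝒜 t) (hdim : ringKrullDim (A ⧸ Ideal.span (W : Set A)) ≤ r) :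
    ∃ f ∈ W, ∀ g, f * g ∈ J → g ∈ J := by
  obtain ⟨w, hw, hreg⟩ := exists_mem_forall_regular_mod (fun _ : Unit => J) W (by
    intro _ u hu
    by_contra! hcon
    obtain ⟨i, hi⟩ := exists_decompose_notMem 𝒜 hu
    have hle : Ideal.span (W : Set A) ≤ J.colon {(decompose 𝒜 u i : A)} := by
      rw [Ideal.span_le]
      intro w hw
      rw [SetLike.mem_coe, Submodule.mem_colon_singleton, smul_eq_mul,
        ← coe_decompose_mul_add_of_left_mem 𝒜 (hWt hw)]
      exact hJ _ (hcon w hw)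
    have h1 := h.le_ringKrullDim_quotient_colon 𝒜 hneg hJ (SetLike.coe_mem _) hi
    have h2 := ringKrullDim_le_of_surjective _ (Ideal.Quotient.factor_surjective hle)
    have h3 := (h1.trans h2).trans hdim
    have : r + 1 ≤ r := by exact_mod_cast h3
    omega)
  exact ⟨w, hw, hreg ()⟩

end Graded

theorem mem_sup_span_singleton_iff {A : Type*} [CommRing A] {J : Ideal A} {x z : A} :
    z ∈ J ⊔ Ideal.span {x} ↔ ∃ y, z - x * y ∈ J := by
  rw [sup_comm, Submodule.mem_sup]
  constructor
  · rintro ⟨_, hb, j, hj, rfl⟩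
    obtain ⟨y, rfl⟩ := Ideal.mem_span_singleton'.mp hb
    exact ⟨y, by convert hj using 1; ring⟩
  · rintro ⟨y, hy⟩
    exact ⟨x * y, Ideal.mul_mem_right _ _ (Ideal.mem_span_singleton_self x), _, hy, by ring⟩

section Exchange

open DirectSum

variable {F A : Type*} [Field F] [CommRing A] [Algebra F A] (𝒜 : ℤ → Submodule F A)

/-- If `a`, `f` are homogeneous nonzerodivisors modulo `J` and `A ⧸ (J + (a))` vanishes in degrees
greater than `s + deg a`, then `A ⧸ (J + (f))` vanishes in degrees greater than `s + deg f`. -/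
theorem mem_sup_span_singleton_of_forall_mem_sup_span_singleton [GradedAlgebra 𝒜]
    [∀ k, Module.Finite F (𝒜 k)] {J : Ideal A} (hJ : J.IsHomogeneous 𝒜) {s α e : ℤ} (hα : 0 < α)
    (he : 0 ≤ e) {a f : A} (ha : a ∈ 𝒜 α) (hf : f ∈ 𝒜 e) (hareg : ∀ h, a * h ∈ J → h ∈ J)
    (hfreg : ∀ h, f * h ∈ J → h ∈ J)
    (hs : ∀ k, s + α < k → ∀ g ∈ 𝒜 k, g ∈ J ⊔ Ideal.span {a}) :
    ∀ k, s + e < k → ∀ g ∈ 𝒜 k, g ∈ J ⊔ Ideal.span {f} := by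
  let π : A →ₗ[F] A ⧸ J := (Ideal.Quotient.mkₐ F J).toLinearMap
  have hπ (x y : A) : π x = π y ↔ x - y ∈ J := Ideal.Quotient.eq
  have hπmul (x y : A) : π (x * y) = π x * π y := map_mul (Ideal.Quotient.mkₐ F J) x y
  let V : ℤ → Submodule F (A ⧸ J) := fun k => (𝒜 k).map π
  let φ : ℤ → ℕ := fun k => Module.finrank F (V k)
  have hinj (x : A) (hx : ∀ h, x * h ∈ J → h ∈ J) :
      Function.Injective (LinearMap.mulLeft F (π x)) := by
    rw [injective_iff_map_eq_zero]
    intro y hy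
    obtain ⟨y, rfl⟩ := Ideal.Quotient.mk_surjective y
    exact Ideal.Quotient.eq_zero_iff_mem.mpr (hx y (Ideal.Quotient.eq_zero_iff_mem.mp hy))
  have hmap {x : A} {i : ℤ} (hx : x ∈ 𝒜 i) (k : ℤ) :
      (V k).map (LinearMap.mulLeft F (π x)) ≤ V (i + k) := by
    rintro _ ⟨_, ⟨y, hy, rfl⟩, rfl⟩
    exact ⟨x * y, SetLike.mul_mem_graded hx hy, hπmul x y⟩
  have hrank {x : A} (hx : ∀ h, x * h ∈ J → h ∈ J) (k : ℤ) :
      Module.finrank F ((V k).map (LinearMap.mulLeft F (π x))) = Module.finrank F (V k) :=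
    (Submodule.equivMapOfInjective _ (hinj x hx) (V k)).finrank_eq.symm
  have hle (k : ℤ) : Module.finrank F (V k) ≤ Module.finrank F (V (e + k)) := by
    rw [← hrank hfreg]
    exact Submodule.finrank_mono (hmap hf k)
  have heq (k : ℤ) (hk : s < k) : Module.finrank F (V (α + k)) = Module.finrank F (V k) := by
    have hV : (V k).map (LinearMap.mulLeft F (π a)) = V (α + k) := by
      refine le_antisymm (hmap ha k) ?_
      rintro _ ⟨g, hg, rfl⟩
      obtain ⟨h, hh, hgh⟩ := exists_sub_mul_mem_of_mem_sup_span_singleton 𝒜 hJ ha hg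
        (hs _ (by omega) g hg)
      exact ⟨π h, ⟨h, hh, rfl⟩, by rw [LinearMap.mulLeft_apply, ← hπmul, eq_comm, hπ]; exact hgh⟩
    rw [← hV, hrank hareg]
  have hle' (n : ℕ) (k : ℤ) : φ k ≤ φ (n * e + k) := by
    induction n with
    | zero => simp
    | succ n ih => exact ih.trans ((hle _).trans_eq (congrArg φ (by push_cast; ring)))
  have heq' (n : ℕ) (k : ℤ) (hk : s < k) : φ (n * α + k) = φ k := by
    induction n with
    | zero => simp
    | succ n ih =>
      rw [← ih]
      exact (congrArg φ (by push_cast; ring)).trans (heq (n * α + k) (by nlinarith))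
  intro k hk g hg
  have hk' : s < k - e := by omega
  have hVle : Module.finrank F (V (e + (k - e))) ≤ Module.finrank F (V (k - e)) := by
    refine ((hle' (α - 1).toNat _).trans_eq (congrArg φ ?_)).trans_eq (heq' e.toNat _ hk')
    rw [Int.toNat_of_nonneg he, Int.toNat_of_nonneg (by omega)]
    ring
  have hV : (V (k - e)).map (LinearMap.mulLeft F (π f)) = V (e + (k - e)) :=
    Submodule.eq_of_le_of_finrank_le (hmap hf _) (by rwa [hrank hfreg])
  have hgV : π g ∈ V (e + (k - e)) := ⟨g, by simpa using hg, rfl⟩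
  rw [← hV] at hgV
  obtain ⟨_, ⟨h, hh, rfl⟩, hgh⟩ := hgV
  rw [LinearMap.mulLeft_apply, ← hπmul, eq_comm, hπ] at hgh
  exact Submodule.mem_sup.mpr ⟨g - f * h, hgh, f * h,
    Ideal.mul_mem_right _ _ (Ideal.mem_span_singleton_self f), by ring⟩

/-- If `a`, `f` are nonzerodivisors modulo `J` and `M` kills no nonzero element modulo `J + (a)`,
then it kills no nonzero element modulo `J + (f)`. -/
theorem exists_mul_notMem_sup_span_singleton {J : Ideal A} {M : Set A} {a f : A}
    (ha : a ∈ Ideal.span M) (hareg : ∀ h, a * h ∈ J → h ∈ J) (hfreg : ∀ h, f * h ∈ J → h ∈ J)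
    (hM : ∀ u ∉ J ⊔ Ideal.span {a}, ∃ w ∈ M, w * u ∉ J ⊔ Ideal.span {a}) :
    ∀ u ∉ J ⊔ Ideal.span {f}, ∃ w ∈ M, w * u ∉ J ⊔ Ideal.span {f} := by
  intro u hu
  by_contra! hcon
  have hau : a * u ∈ J ⊔ Ideal.span {f} := by
    have : Ideal.span M ≤ (J ⊔ Ideal.span {f}).colon {u} :=
      Ideal.span_le.mpr fun w hw => Submodule.mem_colon_singleton.mpr (hcon w hw)
    exact Submodule.mem_colon_singleton.mp (this ha)
  obtain ⟨v, hv⟩ := mem_sup_span_singleton_iff.mp hau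
  by_cases hva : v ∈ J ⊔ Ideal.span {a}
  · obtain ⟨w, hw⟩ := mem_sup_span_singleton_iff.mp hva
    refine hu (mem_sup_span_singleton_iff.mpr ⟨w, hareg _ ?_⟩)
    have : a * (u - f * w) = (a * u - f * v) + f * (v - a * w) := by ring
    rw [this]
    exact J.add_mem hv (J.mul_mem_left f hw)
  · obtain ⟨x, hx, hxv⟩ := hM v hva
    obtain ⟨y, hy⟩ := mem_sup_span_singleton_iff.mp (hcon x hx)
    refine hxv (mem_sup_span_singleton_iff.mpr ⟨y, hfreg _ ?_⟩)
    have : f * (x * v - a * y) = a * (x * u - f * y) - x * (a * u - f * v) := by ring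
    rw [this]
    exact J.sub_mem (J.mul_mem_left a hy) (J.mul_mem_left x hv)

theorem mem_sup_span_singleton_of_mul_mem {J : Ideal A} {c f : A}
    (hf : ∀ h, f * h ∈ J → h ∈ J)
    (hc : ∀ h, c * h ∈ J ⊔ Ideal.span {f} → h ∈ J ⊔ Ideal.span {f}) :
    ∀ h, f * h ∈ J ⊔ Ideal.span {c} → h ∈ J ⊔ Ideal.span {c} := by
  intro h hmem
  obtain ⟨y, hy⟩ := mem_sup_span_singleton_iff.mp hmem
  have hcy : c * y ∈ J ⊔ Ideal.span {f} :=
    mem_sup_span_singleton_iff.mpr ⟨h, by rw [← neg_mem_iff, neg_sub]; exact hy⟩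
  obtain ⟨z, hz⟩ := mem_sup_span_singleton_iff.mp (hc y hcy)
  refine mem_sup_span_singleton_iff.mpr ⟨z, hf _ ?_⟩
  have : f * (h - c * z) = (f * h - c * y) + c * (y - f * z) := by ring
  rw [this]
  exact J.add_mem hy (J.mul_mem_left c hz)

/-- A parameter of a graded algebra generated in degree one may be replaced by any homogeneous
nonzerodivisor. -/
theorem HasRegularParameters.sup_span_singleton [GradedAlgebra 𝒜] [Infinite F]
    [IsNoetherianRing A] [∀ k, Module.Finite F (𝒜 k)]
    (hgen : ∀ k > 0, ∀ g ∈ 𝒜 k, g ∈ Ideal.span (𝒜 1 : Set A)) {r : ℕ} {s e : ℤ} {J : Ideal A}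
    {f : A} (hJ : J.IsHomogeneous 𝒜) (h : HasRegularParameters 𝒜 (r + 1) s J) (he : 0 ≤ e)
    (hf : f ∈ 𝒜 e) (hfreg : ∀ h, f * h ∈ J → h ∈ J) :
    HasRegularParameters 𝒜 r (s + e) (J ⊔ Ideal.span {f}) := by
  have hM {K : Ideal A} {k : ℤ} {x : A} (hk : 0 < k) (hx : x ∈ 𝒜 k)
      (hreg : ∀ h, x * h ∈ K → h ∈ K) : ∀ u ∉ K, ∃ w ∈ (𝒜 1 : Set A), w * u ∉ K := by
    intro u hu
    by_contra! hcon
    have hle : Ideal.span (𝒜 1 : Set A) ≤ K.colon {u} :=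
      Ideal.span_le.mpr fun w hw => Submodule.mem_colon_singleton.mpr (hcon w hw)
    exact hu (hreg u (Submodule.mem_colon_singleton.mp (hle (hgen k hk x hx))))
  induction r generalizing s e J f with
  | zero =>
    obtain ⟨α, hα, a, ha, hareg, h⟩ := h
    exact mem_sup_span_singleton_of_forall_mem_sup_span_singleton 𝒜 hJ hα he ha hf hareg hfreg h
  | succ r ih =>
    obtain ⟨α, hα, a, ha, hareg, h⟩ := h
    obtain ⟨β, hβ, b, hb, hbreg, -⟩ := id h
    have hMa := hM hβ hb hbreg
    have hMf := exists_mul_notMem_sup_span_singleton (hgen α hα a ha) hareg hfreg hMa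
    obtain ⟨c, hc, hcreg⟩ := exists_mem_forall_regular_mod
      ![J, J ⊔ Ideal.span {a}, J ⊔ Ideal.span {f}] (𝒜 1) (by
        intro i
        fin_cases i
        · exact hM hα ha hareg
        · exact hMa
        · exact hMf)
    have hcJ : ∀ h, c * h ∈ J → h ∈ J := hcreg 0
    have hca : ∀ h, c * h ∈ J ⊔ Ideal.span {a} → h ∈ J ⊔ Ideal.span {a} := hcreg 1
    have hcf : ∀ h, c * h ∈ J ⊔ Ideal.span {f} → h ∈ J ⊔ Ideal.span {f} := hcreg 2
    have hac := ih (isHomogeneous_sup_span_singleton 𝒜 hJ ha) h zero_le_one hc hca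
    have hJc : HasRegularParameters 𝒜 (r + 1) (s + 1) (J ⊔ Ideal.span {c}) := by
      refine ⟨α, hα, a, ha, mem_sup_span_singleton_of_mul_mem hareg hca, ?_⟩
      rwa [sup_right_comm, add_right_comm]
    have hcf' := ih (isHomogeneous_sup_span_singleton 𝒜 hJ hc) hJc he hf
      (mem_sup_span_singleton_of_mul_mem hfreg hcf)
    refine ⟨1, one_pos, c, hc, hcf, ?_⟩
    rwa [sup_right_comm, add_right_comm]

end Exchange

section Polynomial

variable {F : Type*} [Field F] {σ : Type*}

attribute [local instance] MvPolynomial.weightedGradedAlgebra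

theorem weight_one_int (d : σ →₀ ℕ) : Finsupp.weight (1 : σ → ℤ) d = d.degree := by
  simp [Finsupp.weight_apply, Finsupp.sum, Finsupp.degree_apply]

theorem mem_weightedHomogeneousSubmodule_one_int {p : MvPolynomial σ F} {k : ℕ} :
    p ∈ weightedHomogeneousSubmodule F (1 : σ → ℤ) k ↔ p.IsHomogeneous k := by
  have hdeg (d : σ →₀ ℕ) : Finsupp.weight (1 : σ → ℕ) d = d.degree :=
    (DFunLike.congr_fun Finsupp.degree_eq_weight_one d).symm
  simp only [mem_weightedHomogeneousSubmodule, IsWeightedHomogeneous, IsHomogeneous,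
    weight_one_int, hdeg, Nat.cast_inj]

theorem weightedHomogeneousSubmodule_one_int_of_neg {k : ℤ} (hk : k < 0) :
    weightedHomogeneousSubmodule F (1 : σ → ℤ) k = ⊥ := by
  refine (Submodule.eq_bot_iff _).mpr fun p hp => ?_
  ext d
  by_contra hd
  have := hp hd
  rw [weight_one_int] at this
  omega

theorem finite_weightedHomogeneousSubmodule_one_int [Finite σ] (k : ℤ) :
    Module.Finite F (weightedHomogeneousSubmodule F (1 : σ → ℤ) k) := by
  rcases lt_or_ge k 0 with hk | hk
  · rw [weightedHomogeneousSubmodule_one_int_of_neg hk]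
    infer_instance
  · lift k to ℕ using hk
    have : weightedHomogeneousSubmodule F (1 : σ → ℤ) k = homogeneousSubmodule σ F k :=
      Submodule.ext fun p => mem_weightedHomogeneousSubmodule_one_int
    rw [this]
    exact Module.Finite.iff_fg.mpr
      (weightedHomogeneousSubmodule_fg F (1 : σ → ℕ) (fun _ => one_ne_zero) k)

theorem mem_span_X_image_univ {k : ℤ} (hk : 0 < k) {p : MvPolynomial σ F}
    (hp : p ∈ weightedHomogeneousSubmodule F (1 : σ → ℤ) k) :
    p ∈ Ideal.span (X '' (Set.univ : Set σ)) := by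
  rw [mem_ideal_span_X_image]
  intro d hd
  have := hp (mem_support_iff.mp hd)
  rw [weight_one_int] at this
  by_contra! hcon
  have h0 : d = 0 := Finsupp.ext fun i => hcon i trivial
  simp [h0] at this
  omega

theorem mem_span_weightedHomogeneousSubmodule_one {k : ℤ} (hk : 0 < k) {p : MvPolynomial σ F}
    (hp : p ∈ weightedHomogeneousSubmodule F (1 : σ → ℤ) k) :
    p ∈ Ideal.span (weightedHomogeneousSubmodule F (1 : σ → ℤ) 1 : Set (MvPolynomial σ F)) := by
  refine Ideal.span_mono ?_ (mem_span_X_image_univ hk hp)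
  rintro _ ⟨i, -, rfl⟩
  exact isWeightedHomogeneous_X F (1 : σ → ℤ) i

theorem mem_span_X_image_of_X_mul_mem {s : Set σ} {i : σ} (hi : i ∉ s) {p : MvPolynomial σ F}
    (hp : X i * p ∈ Ideal.span (X '' s)) : p ∈ Ideal.span (X '' s) := by
  classical
  rw [mem_ideal_span_X_image] at hp ⊢
  intro d hd
  obtain ⟨j, hj, hne⟩ := hp (Finsupp.single i 1 + d) (by
    rwa [mem_support_iff, coeff_X_mul, ← mem_support_iff])
  refine ⟨j, hj, ?_⟩
  have : i ≠ j := fun h => hi (h ▸ hj)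
  simpa [Finsupp.single_apply, this] using hne

/-- The variables not yet killed form a regular sequence modulo the others. -/
theorem hasRegularParameters_span_X_image (m : ℕ) : ∀ r j : ℕ, j + r = m →
    HasRegularParameters (weightedHomogeneousSubmodule F (1 : Fin m → ℤ)) r (-r)
      (Ideal.span (X '' {i : Fin m | (i : ℕ) < j})) := by
  intro r
  induction r with
  | zero =>
    rintro j rfl k hk g hg
    have := mem_span_X_image_univ (by simpa using hk) hg
    refine Ideal.span_mono (Set.image_mono fun i _ => ?_) this
    exact i.2
  | succ r ih =>
    intro j hj
    refine ⟨1, one_pos, X ⟨j, by omega⟩, isWeightedHomogeneous_X F (1 : Fin m → ℤ) _,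
      fun p hp => mem_span_X_image_of_X_mul_mem (by simp) hp, ?_⟩
    convert ih (j + 1) (by omega) using 1
    · push_cast; ring
    · rw [← Ideal.span_union, ← Set.image_singleton, ← Set.image_union]
      congr 2
      ext i
      simp only [Set.mem_union, Set.mem_ofPred_eq, Set.mem_singleton_iff, Fin.ext_iff]
      omega

end Polynomial

section Main

attribute [local instance] MvPolynomial.weightedGradedAlgebra

/-- The ideal `I` contains a regular sequence whose degrees are the `d k`, for `k` descending from
`n - 1`. -/
theorem exists_hasRegularParameters_le {n : ℕ} {I : Ideal (MvPolynomial (Fin (n + 1)) ℂ)}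
    {d : ℤ → ℕ} (hd : ∀ k : ℤ, -1 ≤ k → k ≤ (n : ℤ) - 1 → BaseLocusDimLE (n + 1) I (d k) k) :
    ∀ r i : ℕ, i + r = n + 1 → ∃ J ≤ I,
      J.IsHomogeneous (weightedHomogeneousSubmodule ℂ (1 : Fin (n + 1) → ℤ)) ∧
      HasRegularParameters (weightedHomogeneousSubmodule ℂ (1 : Fin (n + 1) → ℤ)) r
        (-(n + 1) + ∑ j ∈ Finset.range i, (d (n - 1 - j) : ℤ)) J := by
  intro r i
  induction i generalizing r with
  | zero =>
    intro hr
    refine ⟨⊥, bot_le, Ideal.IsHomogeneous.bot _, ?_⟩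
    obtain rfl : r = n + 1 := by omega
    simpa using hasRegularParameters_span_X_image (F := ℂ) (n + 1) (n + 1) 0 (by omega)
  | succ i ih =>
    intro hr
    obtain ⟨J, hJI, hJ, h⟩ := ih (r + 1) (by omega)
    have := finite_weightedHomogeneousSubmodule_one_int (F := ℂ) (σ := Fin (n + 1))
    set t := d (n - 1 - i) with ht
    have hdim := hd (n - 1 - i) (by omega) (by omega)
    rw [BaseLocusDimLE, ← ht, show ((n : ℤ) - 1 - i + 1).toNat = r by omega] at hdim
    obtain ⟨f, ⟨hfI, hft⟩, hf⟩ := h.exists_regular_of_ringKrullDim_le _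
      (fun k => weightedHomogeneousSubmodule_one_int_of_neg) hJ
      (W := I.restrictScalars ℂ ⊓ homogeneousSubmodule (Fin (n + 1)) ℂ t) (t := t)
      (fun p hp => mem_weightedHomogeneousSubmodule_one_int.mpr hp.2) hdim
    have hft' := mem_weightedHomogeneousSubmodule_one_int.mpr hft
    refine ⟨J ⊔ Ideal.span {f}, sup_le hJI ((Ideal.span_singleton_le_iff_mem I).mpr hfI),
      isHomogeneous_sup_span_singleton _ hJ hft', ?_⟩
    rw [Finset.sum_range_succ, ← add_assoc]
    exact h.sup_span_singleton _ (fun k hk g => mem_span_weightedHomogeneousSubmodule_one hk) hJ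
      (Int.natCast_nonneg t) hft' hf

end Main

/-- if `S/I` is Artinian Gorenstein with socle degree `N` and, for
`-1 ≤ k ≤ n - 1`, `d_k` is the smallest `t` such that the base locus of `I_t` has
dimension at most `k`, then `∑_{k=-1}^{n-1} d_k ≥ N + n + 1`. -/
theorem sum_baseLocus_degrees_ge (n N : ℕ) (I : Ideal (MvPolynomial (Fin (n + 1)) ℂ))
    (hAG : IsArtinianGorenstein (n + 1) I N)
    (d : ℤ → ℕ)
    (hd : ∀ k : ℤ, -1 ≤ k → k ≤ (n : ℤ) - 1 →
      IsLeast {t : ℕ | BaseLocusDimLE (n + 1) I t k} (d k)) :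
    (N : ℤ) + n + 1 ≤ ∑ k ∈ Finset.Icc (-1 : ℤ) ((n : ℤ) - 1), (d k : ℤ) := by
  obtain ⟨J, hJI, -, h⟩ := exists_hasRegularParameters_le (fun k hk hk' => (hd k hk hk').1)
    0 (n + 1) rfl
  have hsum : ∑ k ∈ Finset.Icc (-1 : ℤ) ((n : ℤ) - 1), (d k : ℤ) =
      ∑ j ∈ Finset.range (n + 1), (d (n - 1 - j) : ℤ) := by
    refine Finset.sum_nbij' (fun k => (n - 1 - k).toNat) (fun j => n - 1 - j) ?_ ?_ ?_ ?_ ?_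
    · simp only [Finset.mem_Icc, Finset.mem_range]; omega
    · simp only [Finset.mem_Icc, Finset.mem_range]; omega
    · simp only [Finset.mem_Icc]; omega
    · simp only [Finset.mem_range]; omega
    · intro k hk
      rw [Finset.mem_Icc] at hk
      rw [Int.toNat_of_nonneg (by omega), sub_sub_cancel]
  rw [hsum]
  by_contra! hlt
  have htop : Submodule.comap (homogeneousSubmodule (Fin (n + 1)) ℂ N).subtype
      (Submodule.restrictScalars ℂ I) = ⊤ :=
    eq_top_iff.mpr fun p _ =>
      hJI (h N (by omega) p (mem_weightedHomogeneousSubmodule_one_int.mpr p.2))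
  have h1 : hilb (n + 1) I N = 1 := hAG.2.2.2.1
  rw [hilb, htop, Module.finrank_zero_of_subsingleton] at h1
  exact zero_ne_one h1
end

section
/- Let X ⊂ P^4 be a nodal hypersurface of degree d ≥ 3 with defect (i.e., h^4(X, Q) ≥ 2). Then X has at least (d-1)^2 nodes. -/
open MvPolynomial

attribute [local instance] MvPolynomial.gradedAlgebra

/-- The Hessian matrix of second partial derivatives of `f`, evaluated at `x`. -/
noncomputable def hessian (m : ℕ) (f : MvPolynomial (Fin m) ℂ) (x : Fin m → ℂ) :
    Matrix (Fin m) (Fin m) ℂ :=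
  Matrix.of fun i j => MvPolynomial.eval x (pderiv i (pderiv j f))

/-- The singular locus of `V(f)` in `ℙ^{m-1}`. -/
def singLocus (m : ℕ) (f : MvPolynomial (Fin m) ℂ) : Set (Projectivization ℂ (Fin m → ℂ)) :=
  {p | ∀ i, MvPolynomial.eval p.rep (pderiv i f) = 0}

/-- `V(f)` is nodal: at every singular point the (homogeneous) Hessian has corank one,
i.e. the singularity is an ordinary double point. -/
def IsNodal (m : ℕ) (f : MvPolynomial (Fin m) ℂ) : Prop :=
  ∀ x : Fin m → ℂ, x ≠ 0 → (∀ i, MvPolynomial.eval x (pderiv i f) = 0) →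
    (hessian m f x).rank = m - 1

/-- The homogeneous vanishing ideal of a set of points of `ℙ^{m-1}`
(polynomials vanishing on the affine cone). -/
noncomputable def coneVanishingIdeal (m : ℕ) (Sig : Set (Projectivization ℂ (Fin m → ℂ))) :
    Ideal (MvPolynomial (Fin m) ℂ) :=
  Ideal.span {g | ∀ p ∈ Sig, ∀ t : ℂ, MvPolynomial.eval (t • p.rep) g = 0}

/-- A set contained in a finite union of proper subspaces. -/
def IsThin {V : Type*} [AddCommGroup V] [Module ℂ V] (A : Set V) : Prop :=
  ∃ F : Finset (Submodule ℂ V), ⊤ ∉ F ∧ A ⊆ ⋃ W ∈ F, (W : Set V)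

section IsThin

variable {V : Type*} [AddCommGroup V] [Module ℂ V]

lemma IsThin.mono {A A' : Set V} (h : IsThin A') (hA : A ⊆ A') : IsThin A := by
  obtain ⟨F, hF, hA'⟩ := h
  exact ⟨F, hF, hA.trans hA'⟩

lemma isThin_empty : IsThin (∅ : Set V) := ⟨∅, by simp, by simp⟩

lemma IsThin.union {A A' : Set V} (h : IsThin A) (h' : IsThin A') : IsThin (A ∪ A') := by
  classical
  obtain ⟨F, hF, hA⟩ := h
  obtain ⟨F', hF', hA'⟩ := h'
  refine ⟨F ∪ F', by simp [hF, hF'], ?_⟩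
  rw [Finset.set_biUnion_union]
  exact Set.union_subset_union hA hA'

lemma isThin_biUnion {ι : Type*} (t : Finset ι) (A : ι → Set V) (h : ∀ i ∈ t, IsThin (A i)) :
    IsThin (⋃ i ∈ t, A i) := by
  classical
  induction t using Finset.induction_on with
  | empty => simpa using isThin_empty
  | insert i t _ ih =>
    rw [Finset.set_biUnion_insert]
    exact (h i (by simp)).union (ih fun j hj => h j (by simp [hj]))

lemma not_isThin_univ : ¬ IsThin (Set.univ : Set V) := fun ⟨_, hF, hA⟩ =>
  Subspace.biUnion_ne_univ_of_top_notMem hF (Set.univ_subset_iff.1 hA)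

lemma isThin_of_span_ne_top {A : Set V} (h : Submodule.span ℂ A ≠ ⊤) : IsThin A :=
  ⟨{Submodule.span ℂ A}, by simpa using h.symm, by simp [Submodule.subset_span]⟩

end IsThin

section PowersOfSubspace

variable {B : Type*} [CommRing B] [Algebra ℂ B] {U : Submodule ℂ B} [FiniteDimensional ℂ U]

/-- If every power `U ^ i` with `i < s` contains no nonzero element annihilated by `U`, then a
subspace of `U ^ j` of dimension at most `s - j` cannot contain nonzero elements annihilated by
`ℓ` for many `ℓ ∈ U`. -/
lemma isThin_of_annihilated {s : ℕ}
    (hsoc : ∀ i < s, ∀ y ∈ U ^ i, (∀ u ∈ U, u * y = 0) → y = 0) (k : ℕ) :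
    ∀ (j : ℕ) (Z : Submodule ℂ B) [FiniteDimensional ℂ Z] (A : Set U) (φ : U → B),
      j + k ≤ s → Z ≤ U ^ j → Module.finrank ℂ Z ≤ k →
      (∀ l ∈ A, φ l ∈ Z ∧ φ l ≠ 0 ∧ (l : B) * φ l = 0) → IsThin A := by
  induction k with
  | zero =>
    intro j Z _ A φ _ _ hrank hφ
    have hZ : Z = ⊥ := Submodule.finrank_eq_zero.1 (Nat.le_zero.1 hrank)
    refine isThin_empty.mono fun l hl => ?_
    obtain ⟨h1, h2, _⟩ := hφ l hl
    rw [hZ, Submodule.mem_bot] at h1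
    exact h2 h1
  | succ k ih =>
    intro j Z _ A φ hjk hZU hrank hφ
    have key : ∀ l₁ ∈ A, IsThin {l ∈ A | (l₁ : B) * φ l ≠ 0} := by
      intro l₁ hl₁
      refine ih (j + 1) (Z.map (LinearMap.mulLeft ℂ (l₁ : B))) _ (fun l => l₁ * φ l) (by omega)
        ?_ ?_ ?_
      · rintro _ ⟨z, hz, rfl⟩
        rw [pow_succ', LinearMap.mulLeft_apply]
        exact Submodule.mul_mem_mul l₁.2 (hZU hz)
      · have h1 := LinearMap.finrank_range_add_finrank_ker
          ((LinearMap.mulLeft ℂ (l₁ : B)).domRestrict Z)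
        rw [LinearMap.range_domRestrict] at h1
        have h2 : 0 < Module.finrank ℂ ((LinearMap.mulLeft ℂ (l₁ : B)).domRestrict Z).ker := by
          obtain ⟨hz, hne, h0⟩ := hφ l₁ hl₁
          refine Nat.pos_of_ne_zero fun h => hne ?_
          have hmem : (⟨φ l₁, hz⟩ : Z) ∈ ((LinearMap.mulLeft ℂ (l₁ : B)).domRestrict Z).ker := by
            simpa using h0
          rw [Submodule.finrank_eq_zero.1 h, Submodule.mem_bot] at hmem
          exact congrArg Subtype.val hmem
        omega
      · rintro l ⟨hl, hne⟩
        obtain ⟨hz, _, h0⟩ := hφ l hl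
        refine ⟨⟨φ l, hz, rfl⟩, hne, ?_⟩
        rw [mul_left_comm, h0, mul_zero]
    by_contra hA
    have hspan : Submodule.span ℂ A = ⊤ := by
      by_contra h
      exact hA (isThin_of_span_ne_top h)
    obtain ⟨t, htA, ht⟩ := (Submodule.fg_span_iff_fg_span_finset_subset A).1
      (IsNoetherian.noetherian (Submodule.span ℂ A))
    have hthin := isThin_biUnion t (fun l₁ : U => {l ∈ A | (l₁ : B) * φ l ≠ 0})
      fun l₁ hl₁ => key l₁ (htA hl₁)
    refine hA (hthin.mono fun l hl => ?_)
    by_contra hnot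
    simp only [Set.mem_iUnion, Set.mem_ofPred_eq, not_exists, not_and, not_not] at hnot
    obtain ⟨hz, hne, _⟩ := hφ l hl
    refine hne (hsoc j (by omega) _ (hZU hz) fun u hu => ?_)
    have hu' : (⟨u, hu⟩ : U) ∈ Submodule.span ℂ (t : Set U) := by
      rw [← ht, hspan]; trivial
    have hle : Submodule.span ℂ (t : Set U) ≤
        ((LinearMap.mulRight ℂ (φ l)).comp U.subtype).ker :=
      Submodule.span_le.2 fun l₁ hl₁ => by simpa using hnot l₁ hl₁ hl
    simpa using hle hu'

lemma exists_mul_injOn_pow {s j : ℕ}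
    (hsoc : ∀ i < s, ∀ y ∈ U ^ i, (∀ u ∈ U, u * y = 0) → y = 0)
    [FiniteDimensional ℂ ↥(U ^ j)] (hj : j + Module.finrank ℂ ↥(U ^ j) ≤ s) :
    ∃ l ∈ U, ∀ y ∈ U ^ j, l * y = 0 → y = 0 := by
  by_contra! h
  have h' : ∀ l : U, ∃ y ∈ U ^ j, (l : B) * y = 0 ∧ y ≠ 0 := fun l => h l l.2
  choose φ h1 h2 h3 using h'
  exact not_isThin_univ (isThin_of_annihilated hsoc _ j (U ^ j) Set.univ φ hj le_rfl le_rfl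
    fun l _ => ⟨h1 l, h3 l, h2 l⟩)

end PowersOfSubspace

/-- The powers of `U` pair perfectly into degree `s` under `τ`. -/
def PairsPerfectly {B : Type*} [CommRing B] [Algebra ℂ B] (U : Submodule ℂ B) (τ : B →ₗ[ℂ] ℂ)
    (s : ℕ) : Prop :=
  ∀ i ≤ s, ∀ x ∈ U ^ i, (∀ y ∈ U ^ (s - i), τ (x * y) = 0) → x = 0

namespace PairsPerfectly

variable {B : Type*} [CommRing B] [Algebra ℂ B] {U : Submodule ℂ B} {τ : B →ₗ[ℂ] ℂ} {s : ℕ}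

lemma eq_zero_of_mul_eq_zero (h : PairsPerfectly U τ s) {i j : ℕ} (hij : i + j ≤ s) {y : B}
    (hy : y ∈ U ^ i) (h0 : ∀ w ∈ U ^ j, w * y = 0) : y = 0 := by
  refine h i (by omega) y hy fun z hz => ?_
  rw [show s - i = j + (s - i - j) by omega, pow_add] at hz
  induction hz using Submodule.mul_induction_on' with
  | mem_mul_mem a ha b hb => rw [← mul_assoc, mul_comm y a, h0 a ha, zero_mul, map_zero]
  | add x _ y' _ hx hy' => rw [mul_add, map_add, hx, hy', add_zero]

lemma mul_injOn_of_le (h : PairsPerfectly U τ s) {i j : ℕ} (hij : i ≤ j) (hj : j ≤ s) {l : B}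
    (hinj : ∀ y ∈ U ^ j, l * y = 0 → y = 0) {y : B} (hy : y ∈ U ^ i)
    (h0 : l * y = 0) : y = 0 := by
  refine h.eq_zero_of_mul_eq_zero (j := j - i) (by omega) hy fun w hw => hinj _ ?_ ?_
  · rw [show j = j - i + i by omega, pow_add]
    exact Submodule.mul_mem_mul hw hy
  · rw [mul_left_comm, h0, mul_zero]

variable [FiniteDimensional ℂ U]

instance finiteDimensional_pow (n : ℕ) : FiniteDimensional ℂ ↥(U ^ n) :=
  Module.Finite.iff_fg.2 (Submodule.FG.pow (Module.Finite.iff_fg.1 inferInstance) n)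

lemma finrank_pow_le (h : PairsPerfectly U τ s) {i : ℕ} (hi : i ≤ s) :
    Module.finrank ℂ ↥(U ^ i) ≤ Module.finrank ℂ ↥(U ^ (s - i)) := by
  let f : ↥(U ^ i) →ₗ[ℂ] Module.Dual ℂ ↥(U ^ (s - i)) :=
    ((LinearMap.mul ℂ B).compr₂ τ).compl₁₂ (U ^ i).subtype (U ^ (s - i)).subtype
  rw [← Subspace.dual_finrank_eq (V := ↥(U ^ (s - i)))]
  refine LinearMap.finrank_le_finrank_of_injective (f := f) ?_
  rw [← LinearMap.ker_eq_bot, LinearMap.ker_eq_bot']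
  intro x hx
  exact Subtype.ext (h i hi x x.2 fun y hy => LinearMap.congr_fun hx ⟨y, hy⟩)

lemma finrank_pow_eq (h : PairsPerfectly U τ s) {i : ℕ} (hi : i ≤ s) :
    Module.finrank ℂ ↥(U ^ i) = Module.finrank ℂ ↥(U ^ (s - i)) := by
  refine (h.finrank_pow_le hi).antisymm ?_
  have := h.finrank_pow_le (Nat.sub_le s i)
  rwa [Nat.sub_sub_self hi] at this

lemma finrank_map_mul {l : B} {Y : Submodule ℂ B} [FiniteDimensional ℂ Y]
    (hinj : ∀ y ∈ Y, l * y = 0 → y = 0) :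
    Module.finrank ℂ ↥(Y.map (LinearMap.mulLeft ℂ l)) = Module.finrank ℂ Y := by
  rw [← LinearMap.range_domRestrict]
  refine LinearMap.finrank_range_of_inj ?_
  rw [← LinearMap.ker_eq_bot, LinearMap.ker_eq_bot']
  intro y hy
  exact Subtype.ext (hinj y y.2 (by simpa using hy))

omit [FiniteDimensional ℂ U] in
/-- Simultaneous eigenvector for the maps `ℓ⁻¹ u` on a space `V` with `U V ⊆ ℓ V`. -/
lemma exists_common_eigenvector {l : B} (hl : l ∈ U) (n : ℕ) :
    ∀ (Y : Submodule ℂ B) [FiniteDimensional ℂ Y], Module.finrank ℂ Y ≤ n → Y ≠ ⊥ →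
      (∀ y ∈ Y, l * y = 0 → y = 0) → (∀ y ∈ Y, ∀ u ∈ U, l * (u * y) = 0 → u * y = 0) →
      (∀ u ∈ U, ∀ y ∈ Y, ∃ z ∈ Y, u * y = l * z) →
      ∃ y ∈ Y, y ≠ 0 ∧ ∀ u ∈ U, ∃ c : ℂ, u * y = c • (l * y) := by
  induction n with
  | zero =>
    intro Y _ hr hne
    exact absurd (Submodule.finrank_eq_zero.1 (Nat.le_zero.1 hr)) hne
  | succ n ih =>
    intro Y _ hr hne hinj hinj' hsub
    by_cases hall : ∀ u ∈ U, ∃ c : ℂ, ∀ y ∈ Y, u * y = c • (l * y)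
    · obtain ⟨y, hy, hy0⟩ := (Submodule.ne_bot_iff _).1 hne
      refine ⟨y, hy, hy0, fun u hu => ?_⟩
      obtain ⟨c, hc⟩ := hall u hu
      exact ⟨c, hc y hy⟩
    · push Not at hall
      obtain ⟨u, hu, hc⟩ := hall
      have hnt : Nontrivial Y := (Submodule.nontrivial_iff_ne_bot).2 hne
      have hker : ((LinearMap.mulLeft ℂ l).domRestrict Y).ker = ⊥ := by
        rw [LinearMap.ker_eq_bot']
        exact fun y hy => Subtype.ext (hinj y y.2 (by simpa using hy))
      have hrange : ∀ y : Y, (LinearMap.mulLeft ℂ u).domRestrict Y y ∈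
          ((LinearMap.mulLeft ℂ l).domRestrict Y).range := by
        intro y
        obtain ⟨z, hz, hzy⟩ := hsub u hu y y.2
        exact ⟨⟨z, hz⟩, by simpa using hzy.symm⟩
      let e := LinearEquiv.ofInjective ((LinearMap.mulLeft ℂ l).domRestrict Y)
        (LinearMap.ker_eq_bot.1 hker)
      let N : Module.End ℂ Y :=
        e.symm.toLinearMap ∘ₗ ((LinearMap.mulLeft ℂ u).domRestrict Y).codRestrict _ hrange
      have hN : ∀ y : Y, l * (N y : B) = u * y := fun y =>
        congrArg Subtype.val
          (e.apply_symm_apply (((LinearMap.mulLeft ℂ u).domRestrict Y).codRestrict _ hrange y))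
      obtain ⟨c, hc'⟩ := Module.End.exists_eigenvalue N
      obtain ⟨v, hv⟩ := hc'.exists_hasEigenvector
      let Y' := Y ⊓ (LinearMap.mulLeft ℂ (u - c • l)).ker
      have hY' : ∀ y, y ∈ Y' ↔ y ∈ Y ∧ u * y = c • (l * y) := fun y => by
        simp [Y', sub_mul, sub_eq_zero]
      have hv' : (v : B) ∈ Y' := by
        rw [hY', ← hN, hv.apply_eq_smul]
        exact ⟨v.2, by simp⟩
      have hlt : Y' < Y := by
        refine lt_of_le_of_ne inf_le_left fun heq => ?_
        obtain ⟨y, hy, hne⟩ := hc c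
        rw [← heq, hY'] at hy
        exact hne hy.2
      have hfin : FiniteDimensional ℂ Y' := Submodule.finiteDimensional_of_le hlt.le
      have hlt' := Submodule.finrank_lt_finrank_of_lt hlt
      have hsub' : ∀ u ∈ U, ∀ y ∈ Y', ∃ z ∈ Y', u * y = l * z := by
        intro w hw y hy
        obtain ⟨z, hz, hzy⟩ := hsub w hw y (hlt.le hy)
        refine ⟨z, (hY' z).2 ⟨hz, ?_⟩, hzy⟩
        obtain ⟨z₁, hz₁, hzu⟩ := hsub u hu z hz
        have h1 : l * (z₁ - c • z) = u * z - c • (l * z) := by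
          rw [hzu, mul_sub, mul_smul_comm]
        rw [← sub_eq_zero, ← h1]
        refine hinj' _ (Y.sub_mem hz₁ (Y.smul_mem c hz)) l hl ?_
        rw [h1, mul_sub, mul_smul_comm, mul_left_comm l u, ← hzy, mul_left_comm u w,
          ((hY' y).1 hy).2, mul_smul_comm, mul_left_comm w l, sub_self]
      obtain ⟨y, hy, h⟩ := ih Y' (by omega) ((Submodule.ne_bot_iff _).2
        ⟨v, hv', fun h => hv.2 (Subtype.ext h)⟩) (fun y hy => hinj y (hlt.le hy))
        (fun y hy => hinj' y (hlt.le hy)) hsub'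
      exact ⟨y, hlt.le hy, h⟩

omit [FiniteDimensional ℂ U] in
lemma exists_mul_eq_smul {l ψ : B} (hψ : ∀ u ∈ U, ∃ c : ℂ, u * ψ = c • (l * ψ)) {n : ℕ} {w : B}
    (hw : w ∈ U ^ n) : ∃ c : ℂ, w * ψ = c • (l ^ n * ψ) := by
  induction hw using Submodule.pow_induction_on_left' with
  | algebraMap r => exact ⟨r, by simp [Algebra.smul_def]⟩
  | add x y i _ _ hx hy =>
    obtain ⟨c, hc⟩ := hx
    obtain ⟨c', hc'⟩ := hy
    exact ⟨c + c', by rw [add_mul, hc, hc', add_smul]⟩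
  | mem_mul u hu i x _ hx =>
    obtain ⟨c, hc⟩ := hx
    obtain ⟨c', hc'⟩ := hψ u hu
    refine ⟨c * c', ?_⟩
    rw [mul_assoc, hc, mul_smul_comm, mul_left_comm, hc', mul_smul_comm, smul_smul, pow_succ,
      mul_assoc]

lemma exists_point (h : PairsPerfectly U τ s) (hs : U ^ s ≠ ⊥) {a k : ℕ} (hka : k + 1 ≤ a)
    (has : 2 * a ≤ s + 2) (hk : Module.finrank ℂ ↥(U ^ k) ≤ k) :
    ∃ l ∈ U, ∃ ψ : B, l ^ a * ψ ≠ 0 ∧ ∀ u ∈ U, ∃ c : ℂ, u * ψ = c • (l * ψ) := by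
  have hpow : ∀ i ≤ s, U ^ i ≠ ⊥ := fun i hi h0 => hs <| by
    rw [show s = i + (s - i) by omega, pow_add, h0, Submodule.bot_mul]
  have hk0 : k ≠ 0 := by
    rintro rfl
    exact hpow 0 (Nat.zero_le s) (Submodule.finrank_eq_zero.1 (Nat.le_zero.1 hk))
  obtain ⟨l, hl, hinj⟩ := exists_mul_injOn_pow (U := U) (s := s) (j := s - k)
    (fun i hi y hy h0 => h.eq_zero_of_mul_eq_zero (j := 1) hi hy (by simpa using h0))
    (by rw [← h.finrank_pow_eq (by omega)]; omega)
  have hinj' : ∀ i ≤ s - k, ∀ y ∈ U ^ i, l * y = 0 → y = 0 := fun i hi y hy h0 =>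
    h.mul_injOn_of_le hi (Nat.sub_le s k) hinj hy h0
  have hmap : ∀ i, (U ^ i).map (LinearMap.mulLeft ℂ l) ≤ U ^ (i + 1) := by
    rintro i _ ⟨y, hy, rfl⟩
    rw [pow_succ']
    exact Submodule.mul_mem_mul hl hy
  have hmono : ∀ i ≤ s - k, Module.finrank ℂ ↥(U ^ i) ≤ Module.finrank ℂ ↥(U ^ (i + 1)) := by
    intro i hi
    rw [← finrank_map_mul (hinj' i hi)]
    exact Submodule.finrank_mono (hmap i)
  have hmono' : ∀ i j, i ≤ j → j ≤ s - k + 1 →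
      Module.finrank ℂ ↥(U ^ i) ≤ Module.finrank ℂ ↥(U ^ j) := by
    intro i j hij
    induction j, hij using Nat.le_induction with
    | base => exact fun _ => le_rfl
    | succ j _ ih => exact fun hj => (ih (by omega)).trans (hmono j (by omega))
  have heq : (U ^ (s - a)).map (LinearMap.mulLeft ℂ l) = U ^ (s - a + 1) := by
    refine Submodule.eq_of_le_of_finrank_le (hmap _) ?_
    rw [finrank_map_mul (hinj' _ (by omega))]
    have h1 := hmono' (s - a + 1) (s - k + 1) (by omega) le_rfl
    have h2 := hmono' (k - 1) (s - a) (by omega) (by omega)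
    have h3 := h.finrank_pow_eq (i := k - 1) (by omega)
    rw [show s - (k - 1) = s - k + 1 by omega] at h3
    omega
  obtain ⟨ψ, hψU, hψ0, hψ⟩ := exists_common_eigenvector hl _ (U ^ (s - a)) le_rfl
    (hpow _ (Nat.sub_le s a)) (hinj' _ (by omega))
    (fun y hy u hu => hinj' (s - a + 1) (by omega) _
      (by rw [pow_succ']; exact Submodule.mul_mem_mul hu hy))
    (fun u hu y hy => by
      have hmem : u * y ∈ U ^ (s - a + 1) := by
        rw [pow_succ']; exact Submodule.mul_mem_mul hu hy
      rw [← heq] at hmem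
      obtain ⟨z, hz, hzy⟩ := hmem
      exact ⟨z, hz, hzy.symm⟩)
  refine ⟨l, hl, ψ, fun h0 => hψ0 ?_, hψ⟩
  refine h.eq_zero_of_mul_eq_zero (i := s - a) (j := a) (by omega) hψU fun w hw => ?_
  obtain ⟨c, hc⟩ := exists_mul_eq_smul hψ hw
  rw [hc, h0, smul_zero]

end PairsPerfectly

section LinearAlgebra

lemma finrank_add_finrank_map_le {M N B : Type*} [AddCommGroup M] [Module ℂ M] [AddCommGroup N]
    [Module ℂ N] [FiniteDimensional ℂ N] [AddCommGroup B] [Module ℂ B] (f : M →ₗ[ℂ] N)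
    (q : M →ₗ[ℂ] B) (S : Submodule ℂ M) [FiniteDimensional ℂ S] (W : Submodule ℂ N)
    (hW : W ≤ S.map f) (hq : ∀ g ∈ S, f g ∈ W → q g = 0) :
    Module.finrank ℂ W + Module.finrank ℂ ↥(S.map q) ≤ Module.finrank ℂ ↥(S.map f) := by
  obtain ⟨σ, hσ⟩ := LinearMap.exists_rightInverse_of_surjective (q.submoduleMap S)
    (LinearMap.range_eq_top.2 (q.submoduleMap_surjective S))
  have hσ' : ∀ x : S.map q, q (σ x) = x := fun x =>
    congrArg Subtype.val (LinearMap.congr_fun hσ x)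
  let e : ↥(S.map q) →ₗ[ℂ] N := f ∘ₗ S.subtype ∘ₗ σ
  have hmem : ∀ x, e x ∈ W → x = 0 := fun x hx => Subtype.ext <| by
    rw [← hσ', hq _ (σ x).2 hx]; rfl
  have hrange : Module.finrank ℂ ↥e.range = Module.finrank ℂ ↥(S.map q) := by
    refine LinearMap.finrank_range_of_inj ?_
    rw [← LinearMap.ker_eq_bot, LinearMap.ker_eq_bot']
    exact fun x hx => hmem x (hx ▸ W.zero_mem)
  have hdisj : W ⊓ e.range = ⊥ := by
    rw [Submodule.eq_bot_iff]
    rintro _ ⟨hx, x, rfl⟩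
    rw [hmem x hx, map_zero]
  have h := Submodule.finrank_sup_add_finrank_inf_eq W e.range
  rw [hdisj, finrank_bot, add_zero, hrange] at h
  rw [← h]
  refine Submodule.finrank_mono (sup_le hW ?_)
  rintro _ ⟨x, rfl⟩
  exact Submodule.mem_map_of_mem (σ x).2

lemma finrank_add_finrank_le_card {ι : Type*} [Fintype ι] {c : ι → ℂ} (hc : ∀ i, c i ≠ 0)
    (V W : Submodule ℂ (ι → ℂ)) (hVW : ∀ v ∈ V, ∀ w ∈ W, ∑ i, c i * (v i * w i) = 0) :
    Module.finrank ℂ V + Module.finrank ℂ W ≤ Fintype.card ι := by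
  classical
  let D : (ι → ℂ) →ₗ[ℂ] Module.Dual ℂ (ι → ℂ) :=
    LinearMap.mk₂ ℂ (fun w v => ∑ i, c i * (v i * w i))
      (fun w w' v => by simp [mul_add, Finset.sum_add_distrib])
      (fun r w v => by simp [Finset.mul_sum, mul_left_comm])
      (fun w v v' => by simp [add_mul, mul_add, Finset.sum_add_distrib])
      (fun r w v => by simp [Finset.mul_sum, mul_left_comm, mul_assoc])
  have hD : Function.Injective D := by
    rw [← LinearMap.ker_eq_bot, LinearMap.ker_eq_bot']
    intro w hw
    ext i
    have h := LinearMap.congr_fun hw (Pi.single i 1)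
    simpa [D, Pi.single_apply, hc i] using h
  have h1 := Subspace.finrank_add_finrank_dualAnnihilator_eq V
  rw [Module.finrank_fintype_fun_eq_card] at h1
  rw [← h1, add_le_add_iff_left, (Submodule.equivMapOfInjective D hD W).finrank_eq]
  refine Submodule.finrank_mono ?_
  rintro _ ⟨w, hw, rfl⟩
  rw [Submodule.mem_dualAnnihilator]
  exact fun v hv => hVW v hv w hw

end LinearAlgebra

/-- The largest ideal contained in the kernel of a linear functional. -/
def kernelIdeal {R : Type*} [CommRing R] [Algebra ℂ R] (L : R →ₗ[ℂ] ℂ) : Ideal R where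
  carrier := {g | ∀ h, L (g * h) = 0}
  add_mem' ha hb h := by rw [add_mul, map_add, ha h, hb h, add_zero]
  zero_mem' h := by rw [zero_mul, map_zero]
  smul_mem' r g hg h := by rw [smul_eq_mul, mul_comm r g, mul_assoc, hg]

section Points

variable {σ ι : Type*} [Fintype ι] (P : ι → σ → ℂ) (c : ι → ℂ)

/-- Simultaneous evaluation at a family of points. -/
noncomputable def evalPoints : MvPolynomial σ ℂ →ₗ[ℂ] (ι → ℂ) :=
  LinearMap.pi fun i => (aeval (R := ℂ) (P i)).toLinearMap

omit [Fintype ι] in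
@[simp] lemma evalPoints_apply (g : MvPolynomial σ ℂ) (i : ι) :
    evalPoints P g i = eval (P i) g := by
  simp [evalPoints, aeval_eq_eval]

/-- The weighted sum of values at the given points of the degree `s` component. -/
noncomputable def componentSum (s : ℕ) : MvPolynomial σ ℂ →ₗ[ℂ] ℂ :=
  Fintype.linearCombination ℂ c ∘ₗ evalPoints P ∘ₗ homogeneousComponent s

lemma componentSum_apply {s n : ℕ} {g : MvPolynomial σ ℂ} (hg : g ∈ homogeneousSubmodule σ ℂ n) :
    componentSum P c s g = if s = n then ∑ i, c i * eval (P i) g else 0 := by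
  split_ifs with h
  · simp [componentSum, homogeneousComponent_of_mem hg, h, Fintype.linearCombination_apply,
      mul_comm]
  · simp [componentSum, homogeneousComponent_of_mem hg, h]

lemma mem_kernelIdeal_componentSum {s k : ℕ} {g : MvPolynomial σ ℂ}
    (hg : g ∈ homogeneousSubmodule σ ℂ k)
    (h0 : ∀ n, k + n = s → ∀ h ∈ homogeneousSubmodule σ ℂ n,
      ∑ i, c i * (eval (P i) g * eval (P i) h) = 0) :
    g ∈ kernelIdeal (componentSum P c s) := by
  intro h
  rw [← sum_homogeneousComponent h, Finset.mul_sum, map_sum]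
  refine Finset.sum_eq_zero fun n _ => ?_
  have hn := homogeneousComponent_mem n h
  rw [componentSum_apply P c (IsHomogeneous.mul hg hn)]
  split_ifs with hs
  · simpa using h0 n hs.symm _ hn
  · rfl

/-- The graded Gorenstein quotient attached to `componentSum`. -/
abbrev ComponentQuotient (s : ℕ) : Type _ :=
  MvPolynomial σ ℂ ⧸ kernelIdeal (componentSum P c s)

/-- The quotient map onto `ComponentQuotient`. -/
noncomputable abbrev toQuotient (s : ℕ) : MvPolynomial σ ℂ →ₐ[ℂ] ComponentQuotient P c s :=
  Ideal.Quotient.mkₐ ℂ (kernelIdeal (componentSum P c s))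

/-- The degree one part of `ComponentQuotient`. -/
noncomputable def linearPart (s : ℕ) : Submodule ℂ (ComponentQuotient P c s) :=
  (homogeneousSubmodule σ ℂ 1).map (toQuotient P c s).toLinearMap

lemma linearPart_pow (s n : ℕ) : linearPart P c s ^ n =
    (homogeneousSubmodule σ ℂ n).map (toQuotient P c s).toLinearMap := by
  rw [linearPart, ← Submodule.map_pow, homogeneousSubmodule_one_pow]

/-- The functional induced by `componentSum` on the quotient. -/
noncomputable def quotientSum (s : ℕ) : ComponentQuotient P c s →ₗ[ℂ] ℂ :=
  ((kernelIdeal (componentSum P c s)).restrictScalars ℂ).liftQ (componentSum P c s)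
      (fun g hg => by simpa using hg 1) ∘ₗ
    (Submodule.Quotient.restrictScalarsEquiv ℂ (kernelIdeal (componentSum P c s))).symm.toLinearMap

lemma quotientSum_toQuotient (s : ℕ) (g : MvPolynomial σ ℂ) :
    quotientSum P c s (toQuotient P c s g) = componentSum P c s g := rfl

lemma toQuotient_eq_zero {s : ℕ} {g : MvPolynomial σ ℂ} :
    toQuotient P c s g = 0 ↔ g ∈ kernelIdeal (componentSum P c s) :=
  Ideal.Quotient.eq_zero_iff_mem

lemma pairsPerfectly_linearPart (s : ℕ) :
    PairsPerfectly (linearPart P c s) (quotientSum P c s) s := by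
  intro i hi x hx hxy
  rw [linearPart_pow] at hx
  obtain ⟨g, hg, rfl⟩ := hx
  refine (toQuotient_eq_zero P c).2 (mem_kernelIdeal_componentSum P c hg fun n hn h hh => ?_)
  have h1 := hxy (toQuotient P c s h) (by
    rw [linearPart_pow, show s - i = n by omega]
    exact Submodule.mem_map_of_mem hh)
  rw [AlgHom.toLinearMap_apply, ← map_mul, quotientSum_toQuotient,
    componentSum_apply P c (IsHomogeneous.mul hg hh), if_pos hn.symm] at h1
  simpa using h1

variable [Finite σ]

instance finiteDimensional_homogeneousSubmodule (n : ℕ) :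
    FiniteDimensional ℂ ↥(homogeneousSubmodule σ ℂ n) :=
  Module.Finite.iff_fg.2 (homogeneousSubmodule_fg σ ℂ n)

instance finiteDimensional_linearPart (s : ℕ) : FiniteDimensional ℂ ↥(linearPart P c s) :=
  Module.Finite.map _ _

/-- Lower bound for the number of conditions imposed by the points in degree `k`. -/
lemma le_finrank_map_evalPoints {s a : ℕ} {l₀ : MvPolynomial σ ℂ}
    (hl₀ : l₀ ∈ homogeneousSubmodule σ ℂ 1) (hP : ∀ i, eval (P i) l₀ = 1)
    (hrel : ∀ n < s, ∀ g ∈ homogeneousSubmodule σ ℂ n, ∑ i, c i * eval (P i) g = 0)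
    (hrank : ∀ k < a, k + 1 ≤ Module.finrank ℂ ↥(linearPart P c s ^ k)) {k : ℕ} (hk : k < a) :
    (k + 1) * (k + 2) ≤
      2 * Module.finrank ℂ ↥((homogeneousSubmodule σ ℂ k).map (evalPoints P)) := by
  induction k with
  | zero =>
    have h := finrank_add_finrank_map_le (evalPoints P) (toQuotient P c s).toLinearMap
      (homogeneousSubmodule σ ℂ 0) ⊥ bot_le fun g hg hW => by
        refine (toQuotient_eq_zero P c).2 (mem_kernelIdeal_componentSum P c hg fun n _ h _ => ?_)
        refine Finset.sum_eq_zero fun i _ => ?_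
        rw [← evalPoints_apply, (Submodule.mem_bot ℂ).1 hW]
        simp
    rw [← linearPart_pow] at h
    have := hrank 0 hk
    omega
  | succ k ih =>
    have h := finrank_add_finrank_map_le (evalPoints P) (toQuotient P c s).toLinearMap
      (homogeneousSubmodule σ ℂ (k + 1)) ((homogeneousSubmodule σ ℂ k).map (evalPoints P)) ?_ ?_
    · rw [← linearPart_pow] at h
      have h1 := hrank (k + 1) hk
      have h2 := ih (by omega)
      nlinarith
    · rintro _ ⟨g, hg, rfl⟩
      refine ⟨g * l₀, IsHomogeneous.mul hg hl₀, ?_⟩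
      ext i
      simp [hP]
    · rintro g hg ⟨g', hg', hgg'⟩
      refine (toQuotient_eq_zero P c).2 (mem_kernelIdeal_componentSum P c hg fun n hn h hh => ?_)
      rw [← hrel (k + n) (by omega) (g' * h) (IsHomogeneous.mul hg' hh)]
      refine Finset.sum_congr rfl fun i _ => ?_
      rw [map_mul, ← evalPoints_apply P g, ← hgg', evalPoints_apply]

omit [Finite σ] in
lemma exists_sum_eval_ne_zero [Nonempty ι] (hc : ∀ i, c i ≠ 0) (hP : Function.Injective P) :
    ∃ n, ∃ g ∈ homogeneousSubmodule σ ℂ n, ∑ i, c i * eval (P i) g ≠ 0 := by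
  classical
  by_contra! h
  have hall : ∀ g : MvPolynomial σ ℂ, ∑ i, c i * eval (P i) g = 0 := by
    intro g
    rw [← sum_homogeneousComponent g]
    simp_rw [map_sum, Finset.mul_sum]
    rw [Finset.sum_comm]
    exact Finset.sum_eq_zero fun n _ => h n _ (homogeneousComponent_mem n g)
  obtain ⟨i₀⟩ := ‹Nonempty ι›
  have hsep : ∀ j, ∃ v, j ≠ i₀ → P i₀ v ≠ P j v := by
    intro j
    by_cases hj : j = i₀
    · have : Nonempty σ := by
        by_contra hσ
        rw [not_nonempty_iff] at hσ
        have := h 0 1 (isHomogeneous_one σ ℂ)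
        have hsub : Subsingleton ι := hP.subsingleton
        rw [Fintype.sum_subsingleton _ i₀] at this
        exact hc i₀ (by simpa using this)
      exact ⟨Classical.arbitrary σ, fun hne => absurd hj hne⟩
    · obtain ⟨v, hv⟩ := Function.ne_iff.1 (fun he => hj (hP he).symm : P i₀ ≠ P j)
      exact ⟨v, fun _ => hv⟩
  choose v hv using hsep
  have h0 := hall (∏ j ∈ Finset.univ.erase i₀, (X (v j) - C (P j (v j))))
  rw [Finset.sum_eq_single i₀] at h0
  · refine (mul_ne_zero (hc i₀) ?_) h0
    rw [map_prod]
    refine Finset.prod_ne_zero_iff.2 fun j hj => ?_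
    simpa [sub_eq_zero] using hv j (Finset.ne_of_mem_erase hj)
  · intro i _ hi
    rw [map_prod, Finset.prod_eq_zero (Finset.mem_erase.2 ⟨hi, Finset.mem_univ i⟩) (by simp),
      mul_zero]
  · simp

/-- Fewer than `a ^ 2` points satisfying a relation with nonzero coefficients in degree `2 a - 3`
lie in the base locus of forms of degree `a` that has a further point on any given hyperplane
avoiding them. -/
lemma exists_base_point_of_card_lt [Nonempty ι] (hc : ∀ i, c i ≠ 0) (hP : Function.Injective P)
    {l₀ : MvPolynomial σ ℂ} (hl₀ : l₀ ∈ homogeneousSubmodule σ ℂ 1)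
    (hPl : ∀ i, eval (P i) l₀ = 1) {a : ℕ} (ha : 2 ≤ a)
    (hrel : ∀ g ∈ homogeneousSubmodule σ ℂ (2 * a - 3), ∑ i, c i * eval (P i) g = 0)
    (hcard : Fintype.card ι < a ^ 2) :
    ∃ p : σ → ℂ, p ≠ 0 ∧ eval p l₀ = 0 ∧
      ∀ g ∈ homogeneousSubmodule σ ℂ a, (∀ i, eval (P i) g = 0) → eval p g = 0 := by
  classical
  have hex := exists_sum_eval_ne_zero P c hc hP
  obtain ⟨s, ⟨g₁, hg₁, hg₁0⟩, hmin⟩ : ∃ s, (∃ g ∈ homogeneousSubmodule σ ℂ s,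
      ∑ i, c i * eval (P i) g ≠ 0) ∧ ∀ n < s, ∀ g ∈ homogeneousSubmodule σ ℂ n,
      ∑ i, c i * eval (P i) g = 0 :=
    ⟨Nat.find hex, Nat.find_spec hex, fun n hn => by simpa using Nat.find_min hex hn⟩
  have hs : 2 * a - 3 < s := by
    by_contra! hle
    refine hg₁0 ?_
    have hmem : g₁ * l₀ ^ (2 * a - 3 - s) ∈ homogeneousSubmodule σ ℂ (2 * a - 3) := by
      have := IsHomogeneous.mul hg₁ (IsHomogeneous.pow hl₀ (2 * a - 3 - s))
      rwa [one_mul, show s + (2 * a - 3 - s) = 2 * a - 3 by omega] at this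
    simpa [hPl] using hrel _ hmem
  have hpair := pairsPerfectly_linearPart P c s
  have hne : linearPart P c s ^ s ≠ ⊥ := by
    rw [linearPart_pow, Submodule.ne_bot_iff]
    refine ⟨_, Submodule.mem_map_of_mem hg₁, fun h0 => hg₁0 ?_⟩
    have := quotientSum_toQuotient P c s g₁
    rw [AlgHom.toLinearMap_apply] at h0
    rw [h0, map_zero, componentSum_apply P c hg₁, if_pos rfl] at this
    exact this.symm
  obtain ⟨k, hka, hk⟩ : ∃ k, k < a ∧ Module.finrank ℂ ↥(linearPart P c s ^ k) ≤ k := by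
    by_contra! hrank
    have h1 := le_finrank_map_evalPoints P c hl₀ hPl hmin hrank (k := a - 1) (by omega)
    have h2 := le_finrank_map_evalPoints P c hl₀ hPl hmin hrank (k := a - 2) (by omega)
    have h3 := finrank_add_finrank_le_card hc
      ((homogeneousSubmodule σ ℂ (a - 1)).map (evalPoints P))
      ((homogeneousSubmodule σ ℂ (a - 2)).map (evalPoints P)) (by
        rintro _ ⟨g, hg, rfl⟩ _ ⟨h, hh, rfl⟩
        simpa using hmin (a - 1 + (a - 2)) (by omega) (g * h) (IsHomogeneous.mul hg hh))
    obtain ⟨b, rfl⟩ := Nat.exists_eq_add_of_le ha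
    rw [show 2 + b - 1 = b + 1 by omega] at h1 h3
    rw [show 2 + b - 2 = b by omega] at h2 h3
    nlinarith
  obtain ⟨l, hl, ψ, hψ0, hψ⟩ := hpair.exists_point hne hka (by omega) hk
  have hlψ : l * ψ ≠ 0 := fun h0 => hψ0 <| by
    rw [show a = a - 1 + 1 by omega, pow_succ, mul_assoc, h0, mul_zero]
  choose p hp using fun v : σ => hψ (toQuotient P c s (X v))
    (Submodule.mem_map_of_mem (isHomogeneous_X ℂ v))
  have heval₁ : ∀ g ∈ homogeneousSubmodule σ ℂ 1,
      toQuotient P c s g * ψ = eval p g • (l * ψ) := by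
    intro g hg
    rw [homogeneousSubmodule_one_eq_span_X] at hg
    induction hg using Submodule.span_induction with
    | mem x hx =>
      obtain ⟨v, rfl⟩ := hx
      rw [hp, eval_X]
    | zero => simp
    | add x y _ _ hx hy => rw [map_add, add_mul, hx, hy, map_add, add_smul]
    | smul r x _ hx => rw [map_smul, smul_mul_assoc, hx, smul_eval, mul_smul]
  have heval : ∀ n, ∀ g ∈ homogeneousSubmodule σ ℂ n,
      toQuotient P c s g * ψ = eval p g • (l ^ n * ψ) := by
    intro n g hg
    rw [← homogeneousSubmodule_one_pow] at hg
    induction hg using Submodule.pow_induction_on_left' with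
    | algebraMap r =>
      rw [AlgHom.commutes, algebraMap_eq, eval_C, pow_zero, one_mul, Algebra.smul_def]
    | add x y i _ _ hx hy => rw [map_add, add_mul, hx, hy, map_add, add_smul]
    | mem_mul u hu i x _ hx =>
      rw [map_mul, map_mul, mul_assoc, hx, mul_smul_comm, mul_left_comm, heval₁ u hu,
        mul_smul_comm, smul_smul, ← mul_assoc (l ^ i), ← pow_succ, mul_comm (eval p x)]
  refine ⟨p, ?_, ?_, ?_⟩
  · rintro rfl
    obtain ⟨g, hg, rfl⟩ := hl
    have h1 := heval₁ g hg
    have h2 : eval (0 : σ → ℂ) g = 0 := by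
      rw [eval_zero, constantCoeff_eq]
      exact IsHomogeneous.coeff_eq_zero hg (by simp)
    rw [h2, zero_smul] at h1
    exact hlψ h1
  · have h0 : toQuotient P c s l₀ = 0 :=
      (toQuotient_eq_zero P c).2 (mem_kernelIdeal_componentSum P c hl₀ fun n hn h hh => by
        simpa [hPl] using hmin n (by omega) h hh)
    have h1 := heval₁ l₀ hl₀
    rw [h0, zero_mul, eq_comm, smul_eq_zero] at h1
    exact h1.resolve_right hlψ
  · intro g hg hg0
    have h0 : toQuotient P c s g = 0 :=
      (toQuotient_eq_zero P c).2 (mem_kernelIdeal_componentSum P c hg fun n hn h hh => by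
        simp [hg0])
    have h1 := heval a g hg
    rw [h0, zero_mul, eq_comm, smul_eq_zero] at h1
    exact h1.resolve_right hψ0

end Points

lemma eval_smul_of_isHomogeneous {σ : Type*} {n : ℕ} {g : MvPolynomial σ ℂ}
    (hg : g.IsHomogeneous n) (t : ℂ) (x : σ → ℂ) : eval (t • x) g = t ^ n * eval x g := by
  rw [← mem_homogeneousSubmodule, ← homogeneousSubmodule_one_pow] at hg
  induction hg using Submodule.pow_induction_on_left' with
  | algebraMap r => simp [algebraMap_eq]
  | add x y i _ _ hx hy => rw [map_add, map_add, hx, hy, mul_add]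
  | mem_mul u hu i y _ hy =>
    have h : eval (t • x) u = t * eval x u := by
      rw [homogeneousSubmodule_one_eq_span_X] at hu
      induction hu using Submodule.span_induction with
      | mem u hu =>
        obtain ⟨v, rfl⟩ := hu
        simp
      | zero => simp
      | add u w _ _ hu hw => rw [map_add, map_add, hu, hw, mul_add]
      | smul r u _ hu => rw [smul_eval, smul_eval, hu, mul_left_comm]
    rw [map_mul, map_mul, h, hy, pow_succ]
    ring

lemma exists_linear_form_eval_ne_zero {σ ι : Type*} [Fintype σ] [Finite ι] (Q : ι → σ → ℂ)
    (hQ : ∀ i, Q i ≠ 0) :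
    ∃ l ∈ homogeneousSubmodule σ ℂ 1, ∀ i, eval (Q i) l ≠ 0 := by
  classical
  cases nonempty_fintype ι
  let K : ι → Submodule ℂ (σ → ℂ) := fun i => (Fintype.linearCombination ℂ (Q i)).ker
  have hK : ∀ i, K i ≠ ⊤ := by
    intro i h
    refine hQ i (funext fun v => ?_)
    have hv : Pi.single v 1 ∈ K i := h ▸ Submodule.mem_top
    simpa [K, Fintype.linearCombination_apply_single] using hv
  have hthin := isThin_biUnion Finset.univ (fun i => (K i : Set (σ → ℂ))) fun i _ =>
    isThin_of_span_ne_top (by simpa using hK i)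
  obtain ⟨b, hb⟩ : ∃ b, b ∉ ⋃ i ∈ (Finset.univ : Finset ι), (K i : Set (σ → ℂ)) := by
    by_contra! h
    exact not_isThin_univ (hthin.mono fun b _ => h b)
  refine ⟨∑ v, C (b v) * X v, Submodule.sum_mem _ fun v _ => isHomogeneous_C_mul_X _ _,
    fun i h0 => hb ?_⟩
  simp only [Set.mem_iUnion]
  exact ⟨i, Finset.mem_univ i, by
    simpa [K, Fintype.linearCombination_apply] using h0⟩

lemma exists_relation_of_hilb_lt {m k : ℕ} {Sig : Set (Projectivization ℂ (Fin m → ℂ))}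
    [Fintype Sig] (h : hilb m (coneVanishingIdeal m Sig) k < Fintype.card Sig) :
    ∃ c : Sig → ℂ, c ≠ 0 ∧ ∀ g ∈ homogeneousSubmodule (Fin m) ℂ k,
      ∑ p, c p * eval p.1.rep g = 0 := by
  classical
  let E : ↥(homogeneousSubmodule (Fin m) ℂ k) →ₗ[ℂ] (Sig → ℂ) :=
    (evalPoints fun p : Sig => p.1.rep).domRestrict _
  have hker : Submodule.comap (homogeneousSubmodule (Fin m) ℂ k).subtype
      (Submodule.restrictScalars ℂ (coneVanishingIdeal m Sig)) ≤ E.ker := by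
    rintro ⟨g, hg⟩ hgI
    have hgI' : g ∈ coneVanishingIdeal m Sig := hgI
    have hle : ∀ p : Sig, coneVanishingIdeal m Sig ≤ RingHom.ker (eval p.1.rep) := fun p =>
      Ideal.span_le.2 fun g hg => by simpa using hg p.1 p.2 1
    rw [LinearMap.mem_ker]
    ext p
    simpa [E] using hle p hgI'
  have hlt : E.range < ⊤ := by
    rw [lt_top_iff_ne_top]
    intro htop
    have hsurj : Function.Surjective (Submodule.liftQ _ E hker) := by
      rw [← LinearMap.range_eq_top, Submodule.range_liftQ, htop]
    have hle := LinearMap.finrank_le_finrank_of_surjective hsurj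
    rw [Module.finrank_fintype_fun_eq_card] at hle
    exact absurd h (not_lt.2 hle)
  obtain ⟨φ, hφ, hφE⟩ := Submodule.exists_le_ker_of_lt_top _ hlt
  have hsum : ∀ v, φ v = ∑ p, φ (Pi.single p 1) * v p := fun v => by
    conv_lhs => rw [pi_eq_sum_univ' v]
    simp [map_sum, mul_comm]
  refine ⟨fun p => φ (Pi.single p 1), fun h0 => hφ ?_, fun g hg => ?_⟩
  · ext p
    simpa using congrFun h0 p
  · have h1 : φ (E ⟨g, hg⟩) = 0 := hφE ⟨_, rfl⟩
    rw [hsum] at h1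
    simpa [E] using h1

/-- a nodal hypersurface `X = V(f) ⊂ ℙ^4` of degree `d ≥ 3` with defect
(via Dimca's formula, the nodes fail to impose independent conditions in degree
`2d - 5`, which is equivalent to `h^4(X,ℚ) ≥ 2`) has at least `(d-1)^2` nodes. -/
theorem nodal_threefold_defect_nodes_ge (d : ℕ) (hd : 3 ≤ d)
    (f : MvPolynomial (Fin 5) ℂ) (hf0 : f ≠ 0) (hf : f.IsHomogeneous d)
    (hnodal : IsNodal 5 f)
    (hdefect : hilb 5 (coneVanishingIdeal 5 (singLocus 5 f)) (2 * d - 5) <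
      (singLocus 5 f).ncard) :
    (d - 1) ^ 2 ≤ (singLocus 5 f).ncard := by
  classical
  by_contra! hlt
  have hfin : (singLocus 5 f).Finite := Set.finite_of_ncard_pos (by omega)
  have : Fintype (singLocus 5 f) := hfin.fintype
  rw [Set.ncard_eq_toFinset_card', Set.toFinset_card] at hdefect hlt
  obtain ⟨c, hc0, hc⟩ := exists_relation_of_hilb_lt hdefect
  obtain ⟨l₀, hl₀, hl₀ne⟩ := exists_linear_form_eval_ne_zero
    (fun p : singLocus 5 f => p.1.rep) fun p => p.1.rep_nonzero
  let ι := {p : singLocus 5 f // c p ≠ 0}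
  have : Nonempty ι := by
    obtain ⟨p, hp⟩ := Function.ne_iff.1 hc0
    exact ⟨⟨p, hp⟩⟩
  let t : ι → ℂ := fun p => eval p.1.1.rep l₀
  have ht : ∀ p, t p ≠ 0 := fun p => hl₀ne p.1
  have hpartial : ∀ i, pderiv i f ∈ homogeneousSubmodule (Fin 5) ℂ (d - 1) := fun i => hf.pderiv
  obtain ⟨p, hp0, hpl, hp⟩ := exists_base_point_of_card_lt
    (P := fun p : ι => (t p)⁻¹ • p.1.1.rep) (c := fun p => c p.1 * t p ^ (2 * d - 5))
    (fun p => mul_ne_zero p.2 (pow_ne_zero _ (ht p))) (fun p q hpq => by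
      refine Subtype.ext (Subtype.ext ?_)
      rw [← p.1.1.mk_rep, ← q.1.1.mk_rep, Projectivization.mk_eq_mk_iff']
      refine ⟨t p * (t q)⁻¹, ?_⟩
      have hpq' : (t p)⁻¹ • p.1.1.rep = (t q)⁻¹ • q.1.1.rep := hpq
      rw [mul_smul, ← hpq', smul_inv_smul₀ (ht p)]) hl₀
    (fun p => by
      rw [eval_smul_of_isHomogeneous hl₀, pow_one]
      exact inv_mul_cancel₀ (ht p)) (a := d - 1) (by omega)
    (fun g hg => by
      rw [show 2 * (d - 1) - 3 = 2 * d - 5 by omega] at hg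
      refine Eq.trans ?_ (hc g hg)
      rw [← Fintype.sum_subtype_add_sum_subtype (fun p => c p ≠ 0)]
      have hzero : ∑ p : {p // ¬ c p ≠ 0}, c p.1 * eval p.1.1.rep g = 0 :=
        Finset.sum_eq_zero fun p _ => by rw [not_not.1 p.2, zero_mul]
      rw [hzero, add_zero]
      refine Finset.sum_congr rfl fun p _ => ?_
      rw [eval_smul_of_isHomogeneous hg, mul_assoc, ← mul_assoc (t p ^ _), ← mul_pow,
        mul_inv_cancel₀ (ht p), one_pow, one_mul])
    ((Fintype.card_subtype_le _).trans_lt hlt)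
  have hmem : Projectivization.mk ℂ p hp0 ∈ singLocus 5 f := by
    intro i
    obtain ⟨r, hr⟩ := Projectivization.exists_smul_eq_mk_rep ℂ p hp0
    rw [← hr, Units.smul_def, eval_smul_of_isHomogeneous (hpartial i),
      hp _ (hpartial i) fun q => ?_, mul_zero]
    rw [eval_smul_of_isHomogeneous (hpartial i), q.1.2 i, mul_zero]
  refine hl₀ne ⟨_, hmem⟩ ?_
  obtain ⟨r, hr⟩ := Projectivization.exists_smul_eq_mk_rep ℂ p hp0
  rw [← hr, Units.smul_def, eval_smul_of_isHomogeneous hl₀, hpl, mul_zero]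
end
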